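/- arXiv:1611.06116 — 3 statements merged into one kernel-verified Lean document; each statement's English description precedes it below -/
import Mathlib

section
/- For every positive integer k the following holds: if k is odd, then r(k, x²+8y²+64z²) − r(k, 4x²+8y²+17z²+4xz) = δ_□(k)·(−1)^((√k−1)/2)·(−1)^((k−1)/8)·2√k, and if k is even, then r(k, x²+8y²+64z²) − r(k, 4x²+8y²+17z²+4xz) = 0. -/
open PowerSeries

/-- The formal series `∑ i, w i * X ^ e i`, read coefficientwise. -/
noncomputable def thetaSeries {ι : Type*} (w e : ι → ℤ) : PowerSeries ℤ :=
  PowerSeries.mk fun n => ∑ᶠ i, if e i = (n : ℤ) then w i else 0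

/-- Nonnegative exponents, each bound being met by only finitely many of them. -/
def IsExponent {ι : Type*} (e : ι → ℤ) : Prop :=
  (∀ i, 0 ≤ e i) ∧ ∀ n : ℤ, {i | e i ≤ n}.Finite

namespace IsExponent

variable {ι κ : Type*} {e : ι → ℤ} {f : κ → ℤ}

lemma prod (he : IsExponent e) (hf : IsExponent f) :
    IsExponent fun p : ι × κ => e p.1 + f p.2 := by
  refine ⟨fun p => add_nonneg (he.1 _) (hf.1 _), fun n => ?_⟩
  refine ((he.2 n).prod (hf.2 n)).subset fun p hp => ?_
  have h1 := he.1 p.1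
  have h2 := hf.1 p.2
  simp only [Set.mem_ofPred_eq] at hp
  constructor <;> simp only [Set.mem_ofPred_eq] <;> omega

lemma of_abs_le {e : ℤ → ℤ} (he : ∀ n, |n| ≤ e n) : IsExponent e := by
  refine ⟨fun n => (abs_nonneg n).trans (he n), fun n => ?_⟩
  exact (Set.finite_Icc (-n) n).subset fun m hm => abs_le.mp ((he m).trans hm)

lemma finite_support (he : IsExponent e) (w : ι → ℤ) (n : ℤ) :
    (fun i => if e i = n then w i else 0).HasFiniteSupport :=
  (he.2 n).subset fun i hi => by
    by_contra h
    exact hi (if_neg fun h' => h h'.le)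

end IsExponent

namespace thetaSeries

variable {ι κ : Type*} {w e : ι → ℤ} {v f : κ → ℤ}

lemma coeff_eq_sum {n : ℕ} {s : Finset ι} (hs : ∀ i, e i ≤ n → i ∈ s) :
    coeff n (thetaSeries w e) = ∑ i ∈ s, if e i = (n : ℤ) then w i else 0 := by
  rw [thetaSeries, coeff_mk]
  refine finsum_eq_sum_of_support_subset _ fun i hi => hs i ?_
  by_contra h
  exact hi (if_neg fun h' => h h'.le)

lemma mul_eq (he : IsExponent e) (hf : IsExponent f) :
    thetaSeries w e * thetaSeries v f =
      thetaSeries (fun p : ι × κ => w p.1 * v p.2) (fun p => e p.1 + f p.2) := by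
  ext n
  have hs : ∀ i, e i ≤ n → i ∈ (he.2 n).toFinset := fun i hi => by simpa using hi
  have ht : ∀ j, f j ≤ n → j ∈ (hf.2 n).toFinset := fun j hj => by simpa using hj
  rw [coeff_mul, coeff_eq_sum (s := (he.2 n).toFinset ×ˢ (hf.2 n).toFinset), Finset.sum_product]
  · have key : ∀ p ∈ Finset.HasAntidiagonal.antidiagonal n,
        coeff p.1 (thetaSeries w e) * coeff p.2 (thetaSeries v f) =
          ∑ i ∈ (he.2 n).toFinset, ∑ j ∈ (hf.2 n).toFinset,
            if e i = p.1 ∧ f j = p.2 then w i * v j else 0 := by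
      intro p hp
      rw [Finset.HasAntidiagonal.mem_antidiagonal] at hp
      rw [coeff_eq_sum fun i hi => hs i (by omega), coeff_eq_sum fun j hj => ht j (by omega),
        Finset.sum_mul_sum]
      refine Finset.sum_congr rfl fun i _ => Finset.sum_congr rfl fun j _ => ?_
      rw [ite_zero_mul_ite_zero]
    rw [Finset.sum_congr rfl key, Finset.sum_comm]
    refine Finset.sum_congr rfl fun i _ => ?_
    rw [Finset.sum_comm]
    refine Finset.sum_congr rfl fun j _ => ?_
    obtain ⟨a, ha⟩ := Int.eq_ofNat_of_zero_le (he.1 i)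
    obtain ⟨b, hb⟩ := Int.eq_ofNat_of_zero_le (hf.1 j)
    have hp : ∀ p : ℕ × ℕ, (e i = p.1 ∧ f j = p.2) ↔ (a, b) = p := by
      rintro ⟨c, d⟩
      simp [ha, hb]
    simp only [hp, Finset.sum_ite_eq, Finset.HasAntidiagonal.mem_antidiagonal]
    rw [ha, hb]
    norm_cast
  · intro p hp
    have h1 := he.1 p.1
    have h2 := hf.1 p.2
    exact Finset.mem_product.mpr ⟨hs _ (by omega), ht _ (by omega)⟩

lemma comp_equiv (σ : κ ≃ ι) (hw : ∀ j, w (σ j) = v j) (he : ∀ j, e (σ j) = f j) :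
    thetaSeries w e = thetaSeries v f := by
  ext n
  simp only [thetaSeries, coeff_mk]
  rw [← finsum_comp_equiv σ]
  simp only [hw, he]

lemma comp_injective {σ : κ → ι} (hσ : σ.Injective) (h0 : ∀ i ∉ Set.range σ, w i = 0)
    (hw : ∀ j, w (σ j) = v j) (he : ∀ j, e (σ j) = f j) :
    thetaSeries w e = thetaSeries v f := by
  ext n
  simp only [thetaSeries, coeff_mk, ← hw, ← he]
  rw [← finsum_mem_range (f := fun i => if e i = (n : ℤ) then w i else 0) hσ, finsum_mem_def]
  refine finsum_congr fun i => ?_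
  by_cases hi : i ∈ Set.range σ
  · rw [Set.indicator_of_mem hi]
  · rw [Set.indicator_of_notMem hi, h0 i hi, ite_self]

lemma add_eq (he : IsExponent e) (w₁ w₂ : ι → ℤ) :
    thetaSeries w₁ e + thetaSeries w₂ e = thetaSeries (fun i => w₁ i + w₂ i) e := by
  ext n
  simp only [thetaSeries, coeff_mk, map_add]
  rw [← finsum_add_distrib (he.finite_support w₁ n) (he.finite_support w₂ n)]
  refine finsum_congr fun i => ?_
  split_ifs <;> simp

lemma eq_zero_of_equiv (σ : ι ≃ ι) (hw : ∀ i, w (σ i) = -w i) (he : ∀ i, e (σ i) = e i) :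
    thetaSeries w e = 0 := by
  ext n
  have h := finsum_comp_equiv σ (f := fun i => if e i = (n : ℤ) then w i else 0)
  have h' : ∀ i, (if e (σ i) = (n : ℤ) then w (σ i) else 0) =
      -(if e i = (n : ℤ) then w i else 0) := fun i => by
    rw [he, hw]
    split_ifs <;> simp
  simp only [h', finsum_neg_distrib] at h
  rw [thetaSeries, coeff_mk, map_zero]
  omega

lemma constantCoeff_eq {i₀ : ι} (h : ∀ i, e i = 0 ↔ i = i₀) :
    constantCoeff (thetaSeries w e) = w i₀ := by
  rw [← coeff_zero_eq_constantCoeff_apply, thetaSeries, coeff_mk, Nat.cast_zero,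
    finsum_eq_single _ i₀ fun i hi => if_neg fun h' => hi ((h i).mp h')]
  exact if_pos ((h i₀).mpr rfl)

lemma expand_eq : expand 2 two_ne_zero (thetaSeries w e) = thetaSeries w fun i => 2 * e i := by
  ext n
  rw [coeff_expand]
  simp only [thetaSeries, coeff_mk]
  split_ifs with h
  · obtain ⟨m, rfl⟩ := h
    refine finsum_congr fun i => ?_
    simp
  · rw [finsum_eq_zero_of_forall_eq_zero]
    intro i
    rw [if_neg]
    omega

end thetaSeries

/-! ### Theta functions -/

lemma coe_negOnePow_eq_ite (n : ℤ) : (n.negOnePow : ℤ) = if n % 2 = 0 then 1 else -1 := by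
  split_ifs with h
  · rw [Int.negOnePow_even n (Int.even_iff.mpr h)]; rfl
  · rw [Int.negOnePow_odd n (Int.odd_iff.mpr (by omega))]; rfl

lemma isExponent_sq : IsExponent fun n : ℤ => n ^ 2 :=
  .of_abs_le fun n => by
    rw [← sq_abs]; exact Int.le_self_sq _

lemma abs_le_pronic (n : ℤ) : |n| ≤ 2 * n ^ 2 + n := by
  rcases abs_cases n with ⟨h, h'⟩ | ⟨h, h'⟩ <;> rw [h] <;> nlinarith

lemma isExponent_pronic : IsExponent fun n : ℤ => 2 * n ^ 2 + n :=
  .of_abs_le abs_le_pronic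

lemma isExponent_two_mul_sq : IsExponent fun n : ℤ => 2 * n ^ 2 :=
  .of_abs_le fun n => by nlinarith [sq_abs n, Int.le_self_sq |n|, sq_nonneg n]

lemma isExponent_two_mul_pronic : IsExponent fun n : ℤ => 2 * (2 * n ^ 2 + n) :=
  .of_abs_le fun n => by have := abs_le_pronic n; have := abs_nonneg n; linarith

lemma phi_mul_phi_neg :
    thetaSeries (fun _ : ℤ => 1) (fun n => n ^ 2) *
        thetaSeries (fun n : ℤ => (n.negOnePow : ℤ)) (fun n => n ^ 2) =
      thetaSeries (fun n : ℤ => (n.negOnePow : ℤ)) (fun n => 2 * n ^ 2) ^ 2 := by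
  rw [thetaSeries.mul_eq isExponent_sq isExponent_sq, pow_two,
    thetaSeries.mul_eq isExponent_two_mul_sq isExponent_two_mul_sq]
  have h0 : thetaSeries (fun p : ℤ × ℤ => if (p.1 + p.2) % 2 = 0 then 0 else (p.2.negOnePow : ℤ))
      (fun p => p.1 ^ 2 + p.2 ^ 2) = 0 := by
    refine thetaSeries.eq_zero_of_equiv (Equiv.prodComm ℤ ℤ) (fun p => ?_) fun p => ?_
    · simp only [Equiv.prodComm_apply, Prod.fst_swap, Prod.snd_swap, coe_negOnePow_eq_ite]
      split_ifs <;> omega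
    · simp only [Equiv.prodComm_apply, Prod.fst_swap, Prod.snd_swap]
      ring
  have h1 : thetaSeries (fun p : ℤ × ℤ => if (p.1 + p.2) % 2 = 0 then (p.2.negOnePow : ℤ) else 0)
      (fun p => p.1 ^ 2 + p.2 ^ 2) =
      thetaSeries (fun p : ℤ × ℤ => (p.1.negOnePow : ℤ) * p.2.negOnePow)
        (fun p => 2 * p.1 ^ 2 + 2 * p.2 ^ 2) := by
    refine thetaSeries.comp_injective (σ := fun p : ℤ × ℤ => (p.1 + p.2, p.1 - p.2)) ?_ ?_ ?_ ?_
    · rintro ⟨a, b⟩ ⟨c, d⟩ h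
      simp only [Prod.mk.injEq] at h ⊢
      omega
    · rintro ⟨a, b⟩ h
      refine if_neg fun hab => h ⟨((a + b) / 2, (a - b) / 2), ?_⟩
      simp only [Prod.mk.injEq] at hab ⊢
      omega
    · rintro ⟨a, b⟩
      simp only [coe_negOnePow_eq_ite]
      split_ifs <;> omega
    · rintro ⟨a, b⟩
      simp only
      ring
  rw [← h1, ← add_zero (thetaSeries (fun p : ℤ × ℤ => ite _ _ _) _), ← h0,
    thetaSeries.add_eq (isExponent_sq.prod isExponent_sq)]
  congr 1
  funext p
  split_ifs <;> simp

/-- The bijection with `(4n+1)² + (4m+1)² = 2((4b+1)² + 4a²)`, where `a = n - m`. -/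
def pairEquiv : ℤ × ℤ ≃ ℤ × ℤ where
  toFun p := if p.1 % 2 = 0 then ((2 * p.2 + p.1) / 2, (2 * p.2 - p.1) / 2)
    else ((p.1 - 2 * p.2 - 1) / 2, (-2 * p.2 - 1 - p.1) / 2)
  invFun p := (p.1 - p.2, if (p.1 + p.2) % 2 = 0 then (p.1 + p.2) / 2 else -(p.1 + p.2 + 1) / 2)
  left_inv := by
    rintro ⟨a, b⟩
    simp only
    split_ifs <;> simp only [Prod.mk.injEq] at * <;> omega
  right_inv := by
    rintro ⟨a, b⟩
    simp only
    split_ifs <;> simp only [Prod.mk.injEq] at * <;> omega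

lemma pairEquiv_cases (a b : ℤ) : ∃ c n m : ℤ, pairEquiv (a, b) = (n, m) ∧
    ((a = 2 * c ∧ n = b + c ∧ m = b - c) ∨ (a = 2 * c + 1 ∧ n = c - b ∧ m = -b - 1 - c)) := by
  refine ⟨a / 2, (pairEquiv (a, b)).1, (pairEquiv (a, b)).2, rfl, ?_⟩
  simp only [pairEquiv, Equiv.coe_fn_mk]
  split_ifs <;> simp only <;> omega

lemma pairEquiv_exponent (p : ℤ × ℤ) :
    2 * (pairEquiv p).1 ^ 2 + (pairEquiv p).1 + (2 * (pairEquiv p).2 ^ 2 + (pairEquiv p).2) =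
      p.1 ^ 2 + 2 * (2 * p.2 ^ 2 + p.2) := by
  obtain ⟨a, b⟩ := p
  obtain ⟨c, n, m, h, ⟨rfl, rfl, rfl⟩ | ⟨rfl, rfl, rfl⟩⟩ := pairEquiv_cases a b <;>
    rw [h] <;> ring

lemma phi_mul_psi_sq :
    thetaSeries (fun _ : ℤ => 1) (fun n => n ^ 2) *
        thetaSeries (fun _ : ℤ => 1) (fun n => 2 * (2 * n ^ 2 + n)) =
      thetaSeries (fun _ : ℤ => 1) (fun n => 2 * n ^ 2 + n) ^ 2 := by
  rw [thetaSeries.mul_eq isExponent_sq isExponent_two_mul_pronic, pow_two,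
    thetaSeries.mul_eq isExponent_pronic isExponent_pronic]
  exact (thetaSeries.comp_equiv pairEquiv (w := fun _ => 1 * 1) (fun _ => rfl) pairEquiv_exponent).symm

lemma phi_neg_mul_psi_sq :
    thetaSeries (fun n : ℤ => (n.negOnePow : ℤ)) (fun n => n ^ 2) *
        thetaSeries (fun _ : ℤ => 1) (fun n => 2 * (2 * n ^ 2 + n)) =
      thetaSeries (fun n : ℤ => (n.negOnePow : ℤ)) (fun n => 2 * n ^ 2 + n) ^ 2 := by
  rw [thetaSeries.mul_eq isExponent_sq isExponent_two_mul_pronic, pow_two,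
    thetaSeries.mul_eq isExponent_pronic isExponent_pronic]
  refine (thetaSeries.comp_equiv pairEquiv ?_ pairEquiv_exponent).symm
  rintro ⟨a, b⟩
  obtain ⟨c, n, m, h, h'⟩ := pairEquiv_cases a b
  simp only [h, coe_negOnePow_eq_ite]
  split_ifs <;> omega

lemma jacobi_mul_psi :
    thetaSeries (fun n : ℤ => 4 * n + 1) (fun n => 2 * n ^ 2 + n) *
        thetaSeries (fun _ : ℤ => 1) (fun n => 2 * n ^ 2 + n) =
      thetaSeries (fun n : ℤ => 4 * n + 1) (fun n => 2 * (2 * n ^ 2 + n)) *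
        thetaSeries (fun n : ℤ => (n.negOnePow : ℤ)) (fun n => n ^ 2) := by
  rw [mul_comm (thetaSeries _ fun n : ℤ => 2 * (2 * n ^ 2 + n)),
    thetaSeries.mul_eq isExponent_sq isExponent_two_mul_pronic,
    thetaSeries.mul_eq isExponent_pronic isExponent_pronic]
  have h0 : thetaSeries (fun p : ℤ × ℤ => 2 * p.1)
      (fun p => p.1 ^ 2 + 2 * (2 * p.2 ^ 2 + p.2)) = 0 := by
    refine thetaSeries.eq_zero_of_equiv ((Equiv.neg ℤ).prodCongr (Equiv.refl ℤ)) ?_ ?_ <;>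
      rintro ⟨a, b⟩ <;> simp
  rw [← add_zero (thetaSeries (fun p : ℤ × ℤ => (p.1.negOnePow : ℤ) * _) _), ← h0,
    thetaSeries.add_eq (isExponent_sq.prod isExponent_two_mul_pronic)]
  refine thetaSeries.comp_equiv pairEquiv ?_ pairEquiv_exponent
  rintro ⟨a, b⟩
  obtain ⟨c, n, m, h, h'⟩ := pairEquiv_cases a b
  simp only [h, coe_negOnePow_eq_ite]
  split_ifs <;> omega

lemma pronic_eq_zero_iff (n : ℤ) : 2 * n ^ 2 + n = 0 ↔ n = 0 := by
  refine ⟨fun h => abs_nonpos_iff.mp (h ▸ abs_le_pronic n), ?_⟩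
  rintro rfl
  rfl

lemma psi_neg_mul_phi_neg :
    thetaSeries (fun n : ℤ => (n.negOnePow : ℤ)) (fun n => 2 * n ^ 2 + n) *
        thetaSeries (fun n : ℤ => (n.negOnePow : ℤ)) (fun n => 2 * n ^ 2) =
      thetaSeries (fun _ : ℤ => 1) (fun n => 2 * n ^ 2 + n) *
        thetaSeries (fun n : ℤ => (n.negOnePow : ℤ)) (fun n => n ^ 2) := by
  refine (sq_eq_sq_iff_eq_or_eq_neg.mp ?_).resolve_right fun h => ?_
  · rw [mul_pow, mul_pow, ← phi_neg_mul_psi_sq, ← phi_mul_phi_neg, ← phi_mul_psi_sq]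
    ring
  · have := congrArg constantCoeff h
    rw [map_neg, map_mul, map_mul, thetaSeries.constantCoeff_eq pronic_eq_zero_iff,
      thetaSeries.constantCoeff_eq pronic_eq_zero_iff,
      thetaSeries.constantCoeff_eq fun _ => sq_eq_zero_iff,
      thetaSeries.constantCoeff_eq (i₀ := 0) (by simp)] at this
    simp at this

/-- A series without constant term satisfying `D(q) F(q) = D(q²) G(q)`, with `F(0) = 1`,
vanishes. -/
lemma eq_zero_of_mul_eq_expand_mul {D F G : PowerSeries ℤ} (hD : constantCoeff D = 0)
    (hF : constantCoeff F = 1) (h : D * F = expand 2 two_ne_zero D * G) : D = 0 := by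
  by_contra hne
  have h1 := congrArg order h
  have hF' : order F = 0 := by
    rw [order_zero_of_unit]
    exact isUnit_iff_constantCoeff.mpr (by simp [hF])
  rw [order_mul, order_mul, order_expand, hF', add_zero] at h1
  have h2 : D.order ≠ ⊤ := by simpa using hne
  obtain ⟨n, hn⟩ := ENat.ne_top_iff_exists.mp h2
  have h3 : (n : ℕ∞) ≥ 2 • (n : ℕ∞) := by
    rw [hn]
    exact le_self_add.trans_eq h1.symm
  have h4 : n ≠ 0 := by
    rintro rfl
    have := coeff_order (φ := D) hne
    rw [← hn] at this
    simp [hD] at this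
  rw [nsmul_eq_mul] at h3
  norm_cast at h3
  omega

/-- Jacobi's formula `∑ (4n+1) q^(2n²+n) = ψ(-q) φ(-q) φ(-q²)`. -/
lemma jacobi_eq :
    thetaSeries (fun n : ℤ => 4 * n + 1) (fun n => 2 * n ^ 2 + n) =
      thetaSeries (fun n : ℤ => (n.negOnePow : ℤ)) (fun n => 2 * n ^ 2 + n) *
        (thetaSeries (fun n : ℤ => (n.negOnePow : ℤ)) (fun n => n ^ 2) *
          thetaSeries (fun n : ℤ => (n.negOnePow : ℤ)) (fun n => 2 * n ^ 2)) := by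
  have key : thetaSeries (fun n : ℤ => 4 * n + 1) (fun n => 2 * n ^ 2 + n) -
      thetaSeries (fun _ : ℤ => 1) (fun n => 2 * n ^ 2 + n) *
        thetaSeries (fun n : ℤ => (n.negOnePow : ℤ)) (fun n => n ^ 2) ^ 2 = 0 := by
    refine eq_zero_of_mul_eq_expand_mul
      (F := thetaSeries (fun _ : ℤ => 1) (fun n => 2 * n ^ 2 + n))
      (G := thetaSeries (fun n : ℤ => (n.negOnePow : ℤ)) (fun n => n ^ 2)) ?_ ?_ ?_
    · rw [map_sub, map_mul, map_pow, thetaSeries.constantCoeff_eq pronic_eq_zero_iff,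
        thetaSeries.constantCoeff_eq pronic_eq_zero_iff,
        thetaSeries.constantCoeff_eq fun _ => sq_eq_zero_iff]
      simp
    · rw [thetaSeries.constantCoeff_eq pronic_eq_zero_iff]
    · rw [map_sub, map_mul, map_pow, thetaSeries.expand_eq, thetaSeries.expand_eq,
        thetaSeries.expand_eq, sub_mul, sub_mul, jacobi_mul_psi, ← phi_mul_phi_neg]
      linear_combination (-(thetaSeries (fun n : ℤ => (n.negOnePow : ℤ)) fun n => n ^ 2) ^ 2) *
        phi_mul_psi_sq.symm
  rw [sub_eq_zero.mp key]
  linear_combination (-thetaSeries (fun n : ℤ => (n.negOnePow : ℤ)) fun n => n ^ 2) *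
    psi_neg_mul_phi_neg

lemma finsum_jacobi (N : ℕ) :
    (∑ᶠ p : ℤ × ℤ × ℤ, if 2 * p.1 ^ 2 + p.1 + (p.2.1 ^ 2 + 2 * p.2.2 ^ 2) = (N : ℤ) then
        (p.2.2.negOnePow : ℤ) else 0) =
      (-1) ^ N * ∑ᶠ n : ℤ, if 2 * n ^ 2 + n = (N : ℤ) then 4 * n + 1 else 0 := by
  have h := congrArg (coeff N) jacobi_eq
  rw [thetaSeries.mul_eq isExponent_sq isExponent_two_mul_sq,
    thetaSeries.mul_eq isExponent_pronic (isExponent_sq.prod isExponent_two_mul_sq)] at h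
  simp only [thetaSeries, coeff_mk] at h
  rw [h, mul_finsum]
  refine finsum_congr ?_
  rintro ⟨n, y, z⟩
  simp only
  split_ifs with hN
  · have hs : (n.negOnePow : ℤ) * y.negOnePow = (-1) ^ N := by
      have hN' : (N : ℤ).negOnePow = (n + y).negOnePow := by
        rw [Int.negOnePow_eq_iff, ← hN]
        have : Even (y ^ 2 - y) := by
          rw [pow_two, ← mul_sub_one]
          exact Int.even_mul_pred_self y
        rw [show 2 * n ^ 2 + n + (y ^ 2 + 2 * z ^ 2) - (n + y) =
          2 * (n ^ 2 + z ^ 2) + (y ^ 2 - y) by ring]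
        exact (even_two_mul _).add this
      rw [← Int.coe_negOnePow_natCast, hN', Int.negOnePow_add]
      rfl
    rw [← mul_assoc (n.negOnePow : ℤ), hs, ← mul_assoc, ← mul_pow]
    simp
  · simp

/-! ### Counting representations -/

lemma natCard_even_sub_natCard_odd (N : ℕ) :
    (Nat.card {p : ℤ × ℤ × ℤ // 2 * p.1 ^ 2 + p.1 + (p.2.1 ^ 2 + 2 * p.2.2 ^ 2) = (N : ℤ) ∧
        p.2.2 % 2 = 0} : ℤ) -
      Nat.card {p : ℤ × ℤ × ℤ // 2 * p.1 ^ 2 + p.1 + (p.2.1 ^ 2 + 2 * p.2.2 ^ 2) = (N : ℤ) ∧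
        p.2.2 % 2 = 1} =
      ∑ᶠ p : ℤ × ℤ × ℤ, if 2 * p.1 ^ 2 + p.1 + (p.2.1 ^ 2 + 2 * p.2.2 ^ 2) = (N : ℤ) then
        (p.2.2.negOnePow : ℤ) else 0 := by
  have he := isExponent_pronic.prod (isExponent_sq.prod isExponent_two_mul_sq)
  have hmem : ∀ p : ℤ × ℤ × ℤ, 2 * p.1 ^ 2 + p.1 + (p.2.1 ^ 2 + 2 * p.2.2 ^ 2) = (N : ℤ) →
      p ∈ (he.2 N).toFinset := fun p hp => by simpa using hp.le
  have hcard : ∀ r : ℤ, Nat.card {p : ℤ × ℤ × ℤ //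
      2 * p.1 ^ 2 + p.1 + (p.2.1 ^ 2 + 2 * p.2.2 ^ 2) = (N : ℤ) ∧ p.2.2 % 2 = r} =
      ((he.2 N).toFinset.filter fun p : ℤ × ℤ × ℤ =>
        2 * p.1 ^ 2 + p.1 + (p.2.1 ^ 2 + 2 * p.2.2 ^ 2) = (N : ℤ) ∧ p.2.2 % 2 = r).card := by
    intro r
    refine Nat.subtype_card _ fun p => ?_
    rw [Finset.mem_filter]
    exact ⟨fun h => h.2, fun h => ⟨hmem p h.1, h⟩⟩
  have hsum := thetaSeries.coeff_eq_sum (w := fun p : ℤ × ℤ × ℤ => (p.2.2.negOnePow : ℤ))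
    (n := N) (s := (he.2 N).toFinset) fun p hp => by simpa using hp
  rw [thetaSeries, coeff_mk] at hsum
  rw [hcard, hcard, hsum, Finset.card_filter, Finset.card_filter]
  push_cast
  rw [← Finset.sum_sub_distrib]
  refine Finset.sum_congr rfl fun p _ => ?_
  rw [coe_negOnePow_eq_ite]
  split_ifs <;> omega

lemma emod_eight_of_odd {w y z k : ℤ} (h : w ^ 2 + 8 * y ^ 2 + 16 * z ^ 2 = k) (hw : w % 2 = 1) :
    k % 8 = 1 := by
  obtain ⟨c, rfl⟩ := Int.odd_iff.mpr hw
  obtain ⟨d, hd⟩ := Int.even_mul_succ_self c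
  rw [show k = 8 * (d + y ^ 2 + 2 * z ^ 2) + 1 by linear_combination -h + 4 * hd]
  omega

lemma emod_two_eq {w y z k : ℤ} (h : w ^ 2 + 8 * y ^ 2 + 16 * z ^ 2 = k) : w % 2 = k % 2 := by
  have : w ^ 2 % 2 = w % 2 := by
    rcases Int.emod_two_eq_zero_or_one w with h | h <;> simp [pow_two, Int.mul_emod, h]
  omega

lemma natCard_diagonal_eq (k : ℤ) :
    Nat.card {v : ℤ × ℤ × ℤ // v.1 ^ 2 + 8 * v.2.1 ^ 2 + 64 * v.2.2 ^ 2 = k} =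
      Nat.card {v : ℤ × ℤ × ℤ // v.1 ^ 2 + 8 * v.2.1 ^ 2 + 16 * v.2.2 ^ 2 = k ∧
        v.2.2 % 2 = 0} := by
  refine Nat.card_congr
    ⟨fun v => ⟨(v.1.1, v.1.2.1, 2 * v.1.2.2), ?_, ?_⟩,
      fun v => ⟨(v.1.1, v.1.2.1, v.1.2.2 / 2), ?_⟩, ?_, ?_⟩
  · linear_combination v.2
  · simp
  · have h : v.1.2.2 = 2 * (v.1.2.2 / 2) := by have := v.2.2; omega
    linear_combination v.2.1 - 16 * (v.1.2.2 + 2 * (v.1.2.2 / 2)) * h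
  · rintro ⟨⟨x, y, z⟩, h⟩
    simp
  · rintro ⟨⟨x, y, z⟩, h, h'⟩
    simp only at h'
    simp only [Subtype.mk.injEq, Prod.mk.injEq, true_and]
    omega

lemma natCard_nondiagonal_eq (k : ℤ) :
    Nat.card {v : ℤ × ℤ × ℤ //
        4 * v.1 ^ 2 + 8 * v.2.1 ^ 2 + 17 * v.2.2 ^ 2 + 4 * v.1 * v.2.2 = k} =
      Nat.card {v : ℤ × ℤ × ℤ // v.1 ^ 2 + 8 * v.2.1 ^ 2 + 16 * v.2.2 ^ 2 = k ∧
        v.2.2 % 2 = k % 2} := by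
  refine Nat.card_congr
    ⟨fun v => ⟨(2 * v.1.1 + v.1.2.2, v.1.2.1, v.1.2.2), ?_, ?_⟩,
      fun v => ⟨((v.1.1 - v.1.2.2) / 2, v.1.2.1, v.1.2.2), ?_⟩, ?_, ?_⟩
  · linear_combination v.2
  · have := emod_two_eq (w := 2 * v.1.1 + v.1.2.2) (y := v.1.2.1) (z := v.1.2.2) (k := k)
      (by linear_combination v.2)
    simp only
    omega
  · have h : v.1.1 = 2 * ((v.1.1 - v.1.2.2) / 2) + v.1.2.2 := by
      have := v.2.2
      have := emod_two_eq v.2.1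
      omega
    linear_combination v.2.1 -
      (v.1.1 + (2 * ((v.1.1 - v.1.2.2) / 2) + v.1.2.2)) * h
  · rintro ⟨⟨x, y, z⟩, h⟩
    simp
  · rintro ⟨⟨x, y, z⟩, h, h'⟩
    simp only at h'
    have := emod_two_eq h
    simp only [Subtype.mk.injEq, Prod.mk.injEq, and_true]
    omega

lemma natCard_odd_eq (N : ℕ) (r : ℤ) :
    Nat.card {v : ℤ × ℤ × ℤ // v.1 ^ 2 + 8 * v.2.1 ^ 2 + 16 * v.2.2 ^ 2 = 8 * N + 1 ∧
        v.2.2 % 2 = r} =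
      2 * Nat.card {p : ℤ × ℤ × ℤ // 2 * p.1 ^ 2 + p.1 + (p.2.1 ^ 2 + 2 * p.2.2 ^ 2) = (N : ℤ) ∧
        p.2.2 % 2 = r} := by
  have hbool : Nat.card Bool = 2 := by simp
  refine Eq.trans ?_ ((Nat.card_prod Bool _).trans (congrArg (· * _) hbool))
  refine (Nat.card_eq_of_bijective (fun q : Bool × {p : ℤ × ℤ × ℤ //
      2 * p.1 ^ 2 + p.1 + (p.2.1 ^ 2 + 2 * p.2.2 ^ 2) = (N : ℤ) ∧ p.2.2 % 2 = r} =>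
    (⟨(if q.1 then 4 * q.2.1.1 + 1 else -(4 * q.2.1.1 + 1), q.2.1.2.1, q.2.1.2.2), ?_, q.2.2.2⟩ :
      {v : ℤ × ℤ × ℤ // v.1 ^ 2 + 8 * v.2.1 ^ 2 + 16 * v.2.2 ^ 2 = 8 * N + 1 ∧
        v.2.2 % 2 = r})) ⟨?_, ?_⟩).symm
  · simp only
    split_ifs <;> linear_combination 8 * q.2.2.1
  · rintro ⟨b, ⟨n, y, z⟩, h⟩ ⟨b', ⟨n', y', z'⟩, h'⟩ heq
    simp only [Subtype.mk.injEq, Prod.mk.injEq] at heq ⊢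
    cases b <;> cases b' <;> simp at heq ⊢ <;> omega
  · rintro ⟨⟨w, y, z⟩, h, hr⟩
    simp only at h hr
    have hw := emod_two_eq h
    obtain ⟨n, rfl | rfl⟩ : ∃ n : ℤ, w = 4 * n + 1 ∨ w = -(4 * n + 1) := by
      by_cases h4 : w % 4 = 1
      · exact ⟨w / 4, by omega⟩
      · exact ⟨(-w) / 4, by omega⟩
    · refine ⟨(true, ⟨(n, y, z), ?_, hr⟩), by simp⟩
      simp only
      linarith
    · refine ⟨(false, ⟨(n, y, z), ?_, hr⟩), by simp⟩
      simp only
      linarith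

lemma finsum_jacobi_of_sq {N m : ℕ} (h : 8 * N + 1 = m * m) :
    (∑ᶠ n : ℤ, if 2 * n ^ 2 + n = (N : ℤ) then 4 * n + 1 else 0) =
      (-1) ^ ((m - 1) / 2) * (m : ℤ) := by
  have hm : Odd m := by
    by_contra hm
    have : Even (m * m) := (Nat.not_odd_iff_even.mp hm).mul_left m
    rw [← h] at this
    exact absurd this (by simp [parity_simps])
  obtain ⟨n, hn⟩ : ∃ n : ℤ, 4 * n + 1 = (-1) ^ ((m - 1) / 2) * (m : ℤ) := by
    obtain ⟨t, rfl⟩ := hm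
    rw [show (2 * t + 1 - 1) / 2 = t by omega]
    obtain ⟨u, rfl | rfl⟩ := t.even_or_odd'
    · exact ⟨u, by rw [pow_mul]; push_cast; ring⟩
    · exact ⟨-u - 1, by rw [pow_succ, pow_mul]; push_cast; ring⟩
  have hsq : (4 * n + 1) ^ 2 = 8 * (N : ℤ) + 1 := by
    rw [hn, mul_pow, ← pow_mul, mul_comm _ 2, pow_mul, neg_one_sq, one_pow, one_mul, pow_two]
    exact_mod_cast h.symm
  rw [finsum_eq_single _ n, if_pos (by linarith), hn]
  intro n' hne
  refine if_neg fun h' => ?_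
  have : (4 * n' + 1) ^ 2 = (4 * n + 1) ^ 2 := by linarith
  rcases sq_eq_sq_iff_eq_or_eq_neg.mp this with h | h <;> omega

lemma finsum_jacobi_of_not_isSquare {N : ℕ} (h : ¬ IsSquare (8 * N + 1)) :
    (∑ᶠ n : ℤ, if 2 * n ^ 2 + n = (N : ℤ) then 4 * n + 1 else 0) = 0 := by
  refine finsum_eq_zero_of_forall_eq_zero fun n => if_neg fun hn => h ⟨(4 * n + 1).natAbs, ?_⟩
  zify
  rw [← pow_two, sq_abs, ← hn]
  ring

theorem stmt_4 (k : ℕ) (hk : 0 < k) :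
    (Nat.card {v : ℤ × ℤ × ℤ // v.1 ^ 2 + 8 * v.2.1 ^ 2 + 64 * v.2.2 ^ 2 = (k : ℤ)} : ℤ) -
      (Nat.card {v : ℤ × ℤ × ℤ //
        4 * v.1 ^ 2 + 8 * v.2.1 ^ 2 + 17 * v.2.2 ^ 2 + 4 * v.1 * v.2.2 = (k : ℤ)} : ℤ) =
      if Odd k then
        (if IsSquare k then
          (-1 : ℤ) ^ ((Nat.sqrt k - 1) / 2) * (-1 : ℤ) ^ ((k - 1) / 8) * 2 * (Nat.sqrt k : ℤ)
        else 0)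
      else 0 := by
  rw [natCard_diagonal_eq, natCard_nondiagonal_eq]
  split_ifs with hk2 hsq
  · obtain ⟨m, rfl⟩ := hsq
    have hm8 : m * m % 8 = 1 := by
      have := emod_eight_of_odd (w := m) (y := 0) (z := 0) rfl
        (by exact_mod_cast Nat.odd_iff.mp (Nat.odd_mul.mp hk2).1)
      push_cast [pow_two] at this
      omega
    obtain ⟨N, hN⟩ : ∃ N, 8 * N + 1 = m * m := ⟨m * m / 8, by omega⟩
    rw [Nat.sqrt_eq, ← hN, show ((8 * N + 1 : ℕ) : ℤ) % 2 = 1 by omega]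
    push_cast
    rw [natCard_odd_eq, natCard_odd_eq]
    push_cast
    rw [← mul_sub, natCard_even_sub_natCard_odd, finsum_jacobi, finsum_jacobi_of_sq hN,
      Nat.mul_div_cancel_left N (by norm_num)]
    ring
  · by_cases hk8 : k % 8 = 1
    · obtain ⟨N, rfl⟩ : ∃ N, k = 8 * N + 1 := ⟨k / 8, by omega⟩
      rw [show ((8 * N + 1 : ℕ) : ℤ) % 2 = 1 by omega]
      push_cast
      rw [natCard_odd_eq, natCard_odd_eq]
      push_cast
      rw [← mul_sub, natCard_even_sub_natCard_odd, finsum_jacobi,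
        finsum_jacobi_of_not_isSquare hsq]
      simp
    · have hempty : ∀ r : ℤ, Nat.card {v : ℤ × ℤ × ℤ //
          v.1 ^ 2 + 8 * v.2.1 ^ 2 + 16 * v.2.2 ^ 2 = (k : ℤ) ∧ v.2.2 % 2 = r} = 0 := by
        intro r
        have : IsEmpty {v : ℤ × ℤ × ℤ //
            v.1 ^ 2 + 8 * v.2.1 ^ 2 + 16 * v.2.2 ^ 2 = (k : ℤ) ∧ v.2.2 % 2 = r} := by
          refine ⟨fun v => hk8 ?_⟩
          have h2 := emod_two_eq v.2.1
          have := emod_eight_of_odd v.2.1 (by have := Nat.odd_iff.mp hk2; omega)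
          omega
        exact Nat.card_of_isEmpty
      rw [hempty, hempty, sub_self]
  · rw [show (k : ℤ) % 2 = 0 by have := Nat.not_odd_iff.mp hk2; omega, sub_self]
end

section
/- Let n be a positive integer. Then the number of (x,y,z) ∈ ℤ³ with x²+y²+z² = 8n+1, x ≡ 1 (mod 4), y ≡ 2 (mod 8), and z ≡ 2 (mod 8) is zero if and only if 8n+1 = M² for some positive integer M all of whose prime divisors are congruent to 1 modulo 4. -/
theorem Int.exists_four_mul_add_mul_sq_le {a : ℤ} (ha : 0 < a) (b : ℤ) :
    ∃ t : ℤ, 4 * (b + a * t) ^ 2 ≤ a ^ 2 := by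
  refine ⟨-((2 * b + a) / (2 * a)), ?_⟩
  have h1 := Int.mul_ediv_add_emod (2 * b + a) (2 * a)
  have h2 := Int.emod_lt_of_pos (2 * b + a) (by omega : 0 < 2 * a)
  have h3 := Int.emod_nonneg (2 * b + a) (by omega : 2 * a ≠ 0)
  have h4 : 2 * (b + a * -((2 * b + a) / (2 * a))) ≤ a := by linarith
  have h5 : -a ≤ 2 * (b + a * -((2 * b + a) / (2 * a))) := by linarith
  nlinarith

/-- Gauss reduction of positive definite binary quadratic forms. -/
theorem binary_reduction (k : ℕ) : ∀ a b c : ℤ, 0 < a → 0 < a * c - b ^ 2 → a ≤ k →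
    ∃ p q r s : ℤ, p * s - q * r = 1 ∧ 0 < a * p ^ 2 + 2 * b * p * r + c * r ^ 2 ∧
      3 * (a * p ^ 2 + 2 * b * p * r + c * r ^ 2) ^ 2 ≤ 4 * (a * c - b ^ 2) := by
  induction k with
  | zero => intro a b c ha _ h; push_cast at h; omega
  | succ k ih =>
    intro a b c ha hD hk
    obtain ⟨t, hb⟩ := Int.exists_four_mul_add_mul_sq_le ha b
    have hD' : a * (a * t ^ 2 + 2 * b * t + c) - (b + a * t) ^ 2 = a * c - b ^ 2 := by ring
    generalize hb' : b + a * t = b' at *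
    generalize hc' : a * t ^ 2 + 2 * b * t + c = c' at *
    by_cases h : a ≤ c'
    · refine ⟨1, 0, 0, 1, by norm_num, by nlinarith, ?_⟩
      nlinarith
    · have hc0 : 0 < c' := by
        by_contra hneg
        nlinarith [sq_nonneg b']
      obtain ⟨p, q, r, s, h1, h2, h3⟩ := ih c' (-b') a hc0 (by nlinarith)
        (by push_cast at hk; omega)
      have e : a * (t * p - r) ^ 2 + 2 * b * (t * p - r) * p + c * p ^ 2
          = c' * p ^ 2 + 2 * -b' * p * r + a * r ^ 2 := by
        rw [← hb', ← hc']; ring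
      refine ⟨t * p - r, t * q - s, p, q, by linarith, ?_, ?_⟩
      · rw [e]; exact h2
      · rw [e]; nlinarith

/-- A positive definite binary form of determinant `1` represents only sums of two squares. -/
theorem binary_unimodular (a b c : ℤ) (ha : 0 < a) (hD : a * c - b ^ 2 = 1) (x y : ℤ) :
    ∃ u v : ℤ, a * x ^ 2 + 2 * b * x * y + c * y ^ 2 = u ^ 2 + v ^ 2 := by
  obtain ⟨p, q, r, s, h1, h2, h3⟩ := binary_reduction a.toNat a b c ha (by omega) (by omega)
  have hg : a * p ^ 2 + 2 * b * p * r + c * r ^ 2 = 1 := by nlinarith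
  generalize hh : a * p * q + b * (p * s + q * r) + c * r * s = h at *
  have hk : a * q ^ 2 + 2 * b * q * s + c * s ^ 2 = 1 + h ^ 2 := by
    have : (a * p ^ 2 + 2 * b * p * r + c * r ^ 2) * (a * q ^ 2 + 2 * b * q * s + c * s ^ 2)
        - (a * p * q + b * (p * s + q * r) + c * r * s) ^ 2 =
        (a * c - b ^ 2) * (p * s - q * r) ^ 2 := by ring
    rw [hg, hh, hD, h1] at this
    linarith
  refine ⟨(s * x - q * y) + h * (p * y - r * x), p * y - r * x, ?_⟩
  have hx : x = p * (s * x - q * y) + q * (p * y - r * x) := by linear_combination (-x) * h1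
  have hy : y = r * (s * x - q * y) + s * (p * y - r * x) := by linear_combination (-y) * h1
  generalize s * x - q * y = X at *
  generalize p * y - r * x = Y at *
  subst hx hy
  linear_combination X ^ 2 * hg + 2 * X * Y * hh + Y ^ 2 * hk

/-- A positive definite ternary form of determinant `1` represents only sums of three squares. -/
theorem ternary_unimodular (k : ℕ) : ∀ a b c d e f : ℤ, 0 < a → 0 < a * b - d ^ 2 →
    a * b * c + 2 * d * e * f - a * f ^ 2 - b * e ^ 2 - c * d ^ 2 = 1 → a ≤ k →
    ∀ x y z : ℤ, ∃ u v w : ℤ, a * x ^ 2 + b * y ^ 2 + c * z ^ 2 + 2 * d * x * y + 2 * e * x * z +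
      2 * f * y * z = u ^ 2 + v ^ 2 + w ^ 2 := by
  induction k with
  | zero => intro a b c d e f ha _ _ h; push_cast at h; omega
  | succ k ih =>
    intro a b c d e f ha hab hD hk x y z
    have hG : (a * b - d ^ 2) * (a * c - e ^ 2) - (a * f - d * e) ^ 2 = a := by
      linear_combination a * hD
    by_cases ha1 : a = 1
    · subst ha1
      obtain ⟨u, v, h⟩ := binary_unimodular (1 * b - d ^ 2) (1 * f - d * e) (1 * c - e ^ 2) hab hG y z
      exact ⟨x + d * y + e * z, u, v, by linear_combination h⟩
    obtain ⟨p, q, r, s, h1, h2, h3⟩ := binary_reduction _ _ (a * f - d * e) (a * c - e ^ 2) hab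
      (by rw [hG]; exact ha) (Int.self_le_toNat _)
    rw [hG] at h3
    -- the substitution `y = p Y + q Z`, `z = r Y + s Z`
    generalize hb₁ : b * p ^ 2 + 2 * f * p * r + c * r ^ 2 = b₁
    generalize hc₁ : b * q ^ 2 + 2 * f * q * s + c * s ^ 2 = c₁
    generalize hd₁ : d * p + e * r = d₁
    generalize he₁ : d * q + e * s = e₁
    generalize hf₁ : b * p * q + f * (p * s + q * r) + c * r * s = f₁
    have hg : (a * b - d ^ 2) * p ^ 2 + 2 * (a * f - d * e) * p * r + (a * c - e ^ 2) * r ^ 2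
        = a * b₁ - d₁ ^ 2 := by rw [← hb₁, ← hd₁]; ring
    rw [hg] at h2 h3
    have hD₁ : a * b₁ * c₁ + 2 * d₁ * e₁ * f₁ - a * f₁ ^ 2 - b₁ * e₁ ^ 2 - c₁ * d₁ ^ 2 = 1 := by
      have : a * b₁ * c₁ + 2 * d₁ * e₁ * f₁ - a * f₁ ^ 2 - b₁ * e₁ ^ 2 - c₁ * d₁ ^ 2 =
        (a * b * c + 2 * d * e * f - a * f ^ 2 - b * e ^ 2 - c * d ^ 2) * (p * s - q * r) ^ 2 := by
        rw [← hb₁, ← hc₁, ← hd₁, ← he₁, ← hf₁]; ring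
      rw [this, hD, h1]; norm_num
    obtain ⟨t, hd4⟩ := Int.exists_four_mul_add_mul_sq_le ha d₁
    -- the substitution `x = X + t Y`
    have hg' : a * (b₁ + 2 * t * d₁ + a * t ^ 2) - (d₁ + a * t) ^ 2 = a * b₁ - d₁ ^ 2 := by ring
    have hD₂ : a * (b₁ + 2 * t * d₁ + a * t ^ 2) * c₁ + 2 * (d₁ + a * t) * e₁ * (f₁ + t * e₁)
        - a * (f₁ + t * e₁) ^ 2 - (b₁ + 2 * t * d₁ + a * t ^ 2) * e₁ ^ 2
        - c₁ * (d₁ + a * t) ^ 2 = 1 := by linear_combination hD₁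
    generalize hb₂ : b₁ + 2 * t * d₁ + a * t ^ 2 = b₂ at *
    generalize hd₂ : d₁ + a * t = d₂ at *
    generalize hf₂ : f₁ + t * e₁ = f₂ at *
    rw [← hg'] at h2 h3
    have hlt : b₂ < a := by
      by_contra hle
      push Not at hle
      have h4 : 3 * a ^ 2 ≤ 4 * (a * b₂ - d₂ ^ 2) := by
        linarith [mul_le_mul_of_nonneg_left hle ha.le, sq a]
      have h5 : (3 * a ^ 2) ^ 2 ≤ (4 * (a * b₂ - d₂ ^ 2)) ^ 2 := by gcongr
      have h6 : 27 * a ^ 4 ≤ 64 * a := by linarith [show (3 * a ^ 2) ^ 2 = 9 * a ^ 4 by ring]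
      have h7 : 2 ≤ a := by omega
      have h8 : 8 ≤ a ^ 3 := by
        calc (8 : ℤ) = 2 ^ 3 := by norm_num
          _ ≤ a ^ 3 := by gcongr
      linarith [mul_le_mul_of_nonneg_left h8 ha.le, show a * a ^ 3 = a ^ 4 by ring]
    have hb0 : 0 < b₂ := pos_of_mul_pos_right (by linarith [sq_nonneg d₂] : 0 < a * b₂) ha.le
    obtain ⟨u, v, w, h⟩ := ih b₂ a c₁ d₂ f₂ e₁ hb0 (by linarith) (by linear_combination hD₂)
      (by push_cast at hk; omega) (s * y - q * z) (x - t * (s * y - q * z)) (p * z - r * y)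
    refine ⟨u, v, w, ?_⟩
    rw [← h]
    have hy : y = p * (s * y - q * z) + q * (p * z - r * y) := by linear_combination (-y) * h1
    have hz : z = r * (s * y - q * z) + s * (p * z - r * y) := by linear_combination (-z) * h1
    generalize s * y - q * z = Y at *
    generalize p * z - r * y = Z at *
    subst hy hz hb₂ hd₂ hf₂ hb₁ hc₁ hd₁ he₁ hf₁
    ring

open NumberTheorySymbols in
theorem exists_dvd_sq_add_of_jacobiSym_eq_one {p : ℕ} [Fact p.Prime] {n : ℤ} (h : J(-n | p) = 1) :
    ∃ s : ℤ, (p : ℤ) ∣ s ^ 2 + n := by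
  obtain ⟨r, hr⟩ := ZMod.isSquare_of_jacobiSym_eq_one h
  refine ⟨r.valMinAbs, ?_⟩
  rw [← ZMod.intCast_zmod_eq_zero_iff_dvd]
  push_cast at hr ⊢
  rw [sq, ← hr]
  ring

open NumberTheorySymbols in
theorem sum_three_squares_of_mod_eight_eq_one {N : ℕ} (h8 : N % 8 = 1) (hN : 1 < N) :
    ∃ x y z : ℤ, (N : ℤ) = x ^ 2 + y ^ 2 + z ^ 2 := by
  obtain ⟨e, he⟩ : ∃ e, 3 * N - 1 = 2 * e := ⟨(3 * N - 1) / 2, by omega⟩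
  have hcop : e.Coprime (4 * N) := by
    refine Nat.Coprime.mul_right ?_ ?_
    · have : e.Coprime (2 ^ 2) :=
        Nat.Coprime.pow_right 2 (Nat.coprime_two_right.2 (Nat.odd_iff.2 (by omega)))
      simpa using this
    · refine Nat.coprime_of_dvd' fun k _ h1 h2 => ?_
      have : 1 = 3 * N - 2 * e := by omega
      rw [this]
      exact Nat.dvd_sub (h2.mul_left 3) (h1.mul_left 2)
  obtain ⟨p, hpe, hp, hmod⟩ := Nat.forall_exists_prime_gt_and_modEq e (by omega : 4 * N ≠ 0) hcop
  have := Fact.mk hp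
  obtain ⟨j, hj⟩ := (Nat.modEq_iff_dvd' hpe.le).1 hmod.symm
  have hpj : p = 4 * N * j + e := by omega
  set d := 8 * j + 3 with hd
  have hpd : 2 * p + 1 = d * N := by
    have : d * N = 2 * (4 * N * j) + 3 * N := by rw [hd]; ring
    omega
  have hp4 : p % 4 = 1 := by
    rw [hpj, mul_assoc]; omega
  have hd8 : d % 8 = 3 := by omega
  have hdodd : Odd d := Nat.odd_iff.2 (by omega)
  have hJ : J(-(d : ℤ) | p) = 1 := by
    rw [jacobiSym.neg _ (Nat.odd_iff.2 (by omega)), ZMod.χ₄_nat_one_mod_four hp4, one_mul,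
      jacobiSym.quadratic_reciprocity_one_mod_four' hdodd hp4]
    have h1 : J((2 * p : ℤ) | d) = J(-1 | d) := by
      apply jacobiSym.mod_left'
      apply Int.emod_emod_of_dvd _ (dvd_refl (d : ℤ)) |>.symm.trans
      rw [Int.emod_emod_of_dvd _ (dvd_refl (d : ℤ))]
      apply Int.ModEq.symm
      rw [Int.modEq_iff_dvd]
      exact ⟨N, by push_cast [← Nat.cast_mul, ← hpd]; ring⟩
    rw [jacobiSym.mul_left, jacobiSym.at_two hdodd, jacobiSym.at_neg_one hdodd,
      ZMod.χ₄_nat_three_mod_four (by omega), ZMod.χ₈_nat_mod_eight, hd8] at h1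
    have : ZMod.χ₈ ((3 : ℕ) : ZMod 8) = -1 := by decide
    rw [this] at h1
    linarith
  obtain ⟨s₀, hs₀⟩ := exists_dvd_sq_add_of_jacobiSym_eq_one hJ
  obtain ⟨s, hs, hsodd⟩ : ∃ s : ℤ, (p : ℤ) ∣ s ^ 2 + d ∧ s % 2 = 1 := by
    rcases Int.emod_two_eq_zero_or_one s₀ with h | h
    · refine ⟨s₀ + p, ?_, by omega⟩
      have : (s₀ + p) ^ 2 + d = (s₀ ^ 2 + d) + p * (2 * s₀ + p) := by ring
      rw [this]
      exact dvd_add hs₀ (dvd_mul_right _ _)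
    · exact ⟨s₀, hs₀, h⟩
  obtain ⟨a, ha⟩ : (2 * p : ℤ) ∣ s ^ 2 + d := by
    refine IsCoprime.mul_dvd ?_ ?_ hs
    · exact_mod_cast Nat.isCoprime_iff_coprime.2 (Nat.coprime_two_left.2 (Nat.odd_iff.2 (by omega)))
    · obtain ⟨t, rfl⟩ := Int.odd_iff.2 hsodd
      exact ⟨2 * t ^ 2 + 2 * t + 4 * j + 2, by rw [hd]; push_cast; ring⟩
  have hdpos : (0 : ℤ) < d := by positivity
  have hppos : (0 : ℤ) < 2 * p := by have := hp.pos; positivity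
  have hapos : 0 < a := by
    by_contra hneg
    nlinarith [sq_nonneg s]
  have hpd' : (2 * p + 1 : ℤ) = d * N := by exact_mod_cast hpd
  obtain ⟨u, v, w, h⟩ := ternary_unimodular a.toNat a (2 * p) N s 1 0 hapos (by linarith)
    (by linear_combination (-(N : ℤ)) * ha - hpd') (Int.self_le_toNat _) 0 0 1
  exact ⟨u, v, w, by linear_combination h⟩

open NumberTheorySymbols in
theorem exists_prime_three_mod_four_jacobiSym_eq_neg_one {N : ℕ} (h4 : N % 4 = 1)
    (hN : ¬ IsSquare N) : ∃ p : ℕ, p.Prime ∧ p % 4 = 3 ∧ J(N | p) = -1 := by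
  obtain ⟨a, b, hab, hsf⟩ := Nat.sq_mul_squarefree N
  have ha1 : a ≠ 1 := by
    rintro rfl
    exact hN ⟨b, by rw [← hab]; ring⟩
  obtain ⟨l, hl, c, rfl⟩ := Nat.exists_prime_and_dvd ha1
  have := Fact.mk hl
  have hNodd : Odd N := Nat.odd_iff.2 (by omega)
  have hlodd : Odd l := hNodd.of_dvd_nat (hab ▸ (dvd_mul_right l c).mul_left _)
  have hcodd : Odd c := hNodd.of_dvd_nat (hab ▸ (dvd_mul_left c l).mul_left _)
  have hlc : l.Coprime c := Nat.coprime_of_squarefree_mul hsf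
  have hl4c : l.Coprime (4 * c) := by
    refine Nat.Coprime.mul_right ?_ hlc
    have : l.Coprime (2 ^ 2) := Nat.Coprime.pow_right 2 (Nat.coprime_two_right.2 hlodd)
    simpa using this
  have h4c : Nat.Coprime 4 c := by
    have : Nat.Coprime (2 ^ 2) c := Nat.Coprime.pow_left 2 (Nat.coprime_two_left.2 hcodd)
    simpa using this
  obtain ⟨x, hx⟩ := FiniteField.exists_nonsquare (F := ZMod l) (by
    rw [ZMod.ringChar_zmod_n]; rintro rfl; revert hlodd; decide)
  obtain ⟨r₁, hr₁⟩ := Nat.chineseRemainder h4c 3 1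
  obtain ⟨r, hr⟩ := Nat.chineseRemainder hl4c x.val r₁
  have hrx : (r : ZMod l) = x := by
    rw [(ZMod.natCast_eq_natCast_iff _ _ _).2 hr.1, ZMod.natCast_zmod_val]
  have hr4 : r ≡ 3 [MOD 4] := (hr.2.of_mul_right c).trans hr₁.1
  have hrc : r ≡ 1 [MOD c] := (hr.2.of_mul_left 4).trans hr₁.2
  have hcop : r.Coprime (l * (4 * c)) := by
    refine Nat.Coprime.mul_right ?_ (Nat.Coprime.mul_right ?_ ?_)
    · rw [Nat.coprime_comm, hl.coprime_iff_not_dvd, ← ZMod.natCast_eq_zero_iff, hrx]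
      rintro rfl
      exact hx (IsSquare.zero)
    · rw [Nat.Coprime, hr4.gcd_eq]; rfl
    · rw [Nat.Coprime, hrc.gcd_eq]; simp
  have hc0 : c ≠ 0 := by rintro rfl; simp at hcodd
  have hb0 : b ≠ 0 := by rintro rfl; simp at hab; omega
  obtain ⟨p, hpN, hp, hmod⟩ := Nat.forall_exists_prime_gt_and_modEq N
    (mul_ne_zero hl.ne_zero (mul_ne_zero four_ne_zero hc0)) hcop
  have hp4 : p % 4 = 3 := (hmod.of_mul_left l |>.of_mul_right c).trans hr4
  have hpb : Int.gcd p b = 1 := by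
    rw [Int.gcd_natCast_natCast]
    refine (Nat.Prime.coprime_iff_not_dvd hp).2 fun h => ?_
    have h1 := Nat.le_of_dvd (Nat.pos_of_ne_zero hb0) h
    have h2 : b ≤ N := Nat.le_of_dvd (by omega) (hab ▸ (dvd_pow_self b two_ne_zero).mul_right _)
    omega
  refine ⟨p, hp, hp4, ?_⟩
  rw [jacobiSym.quadratic_reciprocity_one_mod_four h4 (Nat.odd_iff.2 (by omega)), ← hab,
    jacobiSym.mul_right' _ (pow_ne_zero 2 hb0) (mul_ne_zero hl.ne_zero hc0), jacobiSym.pow_right,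
    jacobiSym.sq_one hpb, one_mul, jacobiSym.mul_right' _ hl.ne_zero hc0]
  have h1 : J(p | c) = 1 := by
    rw [jacobiSym.mod_left' (a₂ := 1), jacobiSym.one_left]
    exact_mod_cast (hmod.of_mul_left l |>.of_mul_left 4).trans hrc
  rw [h1, mul_one, ZMod.nonsquare_iff_jacobiSym_eq_neg_one]
  rw [Int.cast_natCast, (ZMod.natCast_eq_natCast_iff _ _ _).2 (hmod.of_mul_right (4 * c)), hrx]
  exact hx

/-- Modulo an odd `m`, every integer has a residue of absolute value less than `m / 2`. -/
theorem Int.exists_small_residue {m : ℕ} (hm : Odd m) (a : ℤ) :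
    ∃ t r : ℤ, a = m * t + r ∧ 4 * r ^ 2 < m ^ 2 := by
  obtain ⟨k, rfl⟩ := hm
  refine ⟨(a + k) / (2 * k + 1), (a + k) % (2 * k + 1) - k, ?_, ?_⟩
  · push_cast
    linarith [Int.mul_ediv_add_emod (a + k) (2 * k + 1)]
  · have h1 := Int.emod_nonneg (a + k) (by omega : (2 * k + 1 : ℤ) ≠ 0)
    have h2 := Int.emod_lt_of_pos (a + k) (by omega : (0 : ℤ) < 2 * k + 1)
    push_cast
    nlinarith

namespace Quaternion

/-- The integral quaternion with the given coordinates. -/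
def ofCoords (a b c d : ℤ) : ℍ[ℤ] := ⟨a, b, c, d⟩

@[simp] theorem re_ofCoords (a b c d : ℤ) : (ofCoords a b c d).re = a := rfl

@[simp] theorem imI_ofCoords (a b c d : ℤ) : (ofCoords a b c d).imI = b := rfl

@[simp] theorem imJ_ofCoords (a b c d : ℤ) : (ofCoords a b c d).imJ = c := rfl

@[simp] theorem imK_ofCoords (a b c d : ℤ) : (ofCoords a b c d).imK = d := rfl

theorem exists_two_mul_eq_mul {q : ℍ[ℤ]} (h : Even (normSq q)) :
    ∃ g w : ℍ[ℤ], normSq g = 2 ∧ (2 : ℍ[ℤ]) * w = g * q := by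
  obtain ⟨a, b, c, d, rfl⟩ : ∃ a b c d, q = ofCoords a b c d := ⟨q.re, q.imI, q.imJ, q.imK, rfl⟩
  rw [normSq_def'] at h
  simp only [re_ofCoords, imI_ofCoords, imJ_ofCoords, imK_ofCoords, Int.even_add, Int.even_pow,
    ne_eq, OfNat.ofNat_ne_zero, not_false_eq_true, and_true] at h
  have key : (Even (a - b) ∧ Even (c - d)) ∨ (Even (a - c) ∧ Even (b - d)) ∨
      (Even (a - d) ∧ Even (b - c)) := by
    simp only [Int.even_sub]; tauto
  simp only [two_mul]
  rcases key with ⟨⟨k, hk⟩, ⟨l, hl⟩⟩ | ⟨⟨k, hk⟩, ⟨l, hl⟩⟩ | ⟨⟨k, hk⟩, ⟨l, hl⟩⟩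
  · refine ⟨ofCoords 1 1 0 0, ofCoords k (k + b) l (l + d), by rw [normSq_def']; norm_num, ?_⟩
    ext <;> simp <;> omega
  · refine ⟨ofCoords 1 0 1 0, ofCoords k (l + d) (k + c) (-l), by rw [normSq_def']; norm_num, ?_⟩
    ext <;> simp <;> omega
  · refine ⟨ofCoords 1 0 0 1, ofCoords k l (l + c) (k + d), by rw [normSq_def']; norm_num, ?_⟩
    ext <;> simp <;> omega

theorem exists_small_residue {m : ℕ} (hm : Odd m) (q : ℍ[ℤ]) :
    ∃ t r : ℍ[ℤ], q = (m : ℍ[ℤ]) * t + r ∧ normSq r < m ^ 2 := by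
  obtain ⟨a, b, c, d, rfl⟩ : ∃ a b c d, q = ofCoords a b c d := ⟨q.re, q.imI, q.imJ, q.imK, rfl⟩
  obtain ⟨t₁, r₁, h₁, h₁'⟩ := Int.exists_small_residue hm a
  obtain ⟨t₂, r₂, h₂, h₂'⟩ := Int.exists_small_residue hm b
  obtain ⟨t₃, r₃, h₃, h₃'⟩ := Int.exists_small_residue hm c
  obtain ⟨t₄, r₄, h₄, h₄'⟩ := Int.exists_small_residue hm d
  refine ⟨ofCoords t₁ t₂ t₃ t₄, ofCoords r₁ r₂ r₃ r₄, ?_, ?_⟩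
  · have : (m : ℍ[ℤ]) = ((m : ℤ) : ℍ[ℤ]) := by norm_num
    rw [this]
    ext <;> simp [h₁, h₂, h₃, h₄]
  · rw [normSq_def']
    simp only [re_ofCoords, imI_ofCoords, imJ_ofCoords, imK_ofCoords]
    linarith

/-- Descent in the left ideal of the quaternions `q` with `q * u` divisible by `p`: a norm `p * m`
with `0 < m < p` can be lowered to `p`. -/
theorem exists_normSq_eq_of_small {p : ℕ} (hp : p.Prime) (hp2 : Odd p)
    (u : ℍ[ℤ]) (m : ℕ) :
    0 < m → m < p → (∃ q t : ℍ[ℤ], q * u = (p : ℍ[ℤ]) * t ∧ normSq q = p * m) →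
      ∃ q t : ℍ[ℤ], q * u = (p : ℍ[ℤ]) * t ∧ normSq q = p := by
  induction m using Nat.strong_induction_on with
  | _ m ih =>
    rintro hm0 hmp ⟨q, t, hqt, hq⟩
    have hp0 : (p : ℤ) ≠ 0 := by exact_mod_cast hp.ne_zero
    have hm0' : (m : ℤ) ≠ 0 := by exact_mod_cast hm0.ne'
    rcases Nat.even_or_odd m with hme | hmo
    · obtain ⟨k, rfl⟩ := hme
      obtain ⟨g, w, hg, hw⟩ := exists_two_mul_eq_mul (q := q) (by
        rw [hq]; exact ⟨p * k, by push_cast; ring⟩)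
      refine ih k (by omega) (by omega) (by omega) ⟨w, ?_⟩
      obtain ⟨j, rfl⟩ := hp2
      refine ⟨w * u - j * (g * t), ?_, ?_⟩
      · have h1 : 2 * (w * u) = ((2 * j + 1 : ℕ) : ℍ[ℤ]) * (g * t) := by
          rw [← mul_assoc, hw, mul_assoc, hqt, ← mul_assoc, ← mul_assoc, Nat.cast_comm]
        have h2 : ((2 * j + 1 : ℕ) : ℍ[ℤ]) * (w * u) = j * (2 * (w * u)) + w * u := by
          push_cast
          rw [add_mul, one_mul, ← mul_assoc (j : ℍ[ℤ]), (Nat.cast_commute j (2 : ℍ[ℤ])).eq]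
        rw [mul_sub, h2, h1, ← mul_assoc (j : ℍ[ℤ]),
          ← mul_assoc ((2 * j + 1 : ℕ) : ℍ[ℤ]), (Nat.cast_commute j _).eq]
        abel
      · have h1 := congrArg normSq hw
        rw [map_mul, map_mul, hg, hq] at h1
        have h2 : normSq (2 : ℍ[ℤ]) = 4 := normSq_natCast (R := ℤ) 2
        rw [h2] at h1
        push_cast at h1 ⊢
        linarith
    · by_cases hm1 : m = 1
      · exact ⟨q, t, hqt, by simpa [hm1] using hq⟩
      obtain ⟨s, r, hqr, hr⟩ := exists_small_residue hmo q
      have hrne : normSq r ≠ 0 := by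
        intro h
        rw [normSq_eq_zero.1 h, add_zero] at hqr
        rw [hqr, map_mul, normSq_natCast] at hq
        have h1 : (m : ℤ) ∣ p := ⟨normSq s, by
          apply mul_right_cancel₀ hm0'
          linear_combination -hq⟩
        rcases (Nat.dvd_prime hp).1 (Int.natCast_dvd_natCast.1 h1) with h | h <;> omega
      set w := (p : ℍ[ℤ]) - star s * q with hw
      have hrw : star r * q = m * w := by
        have h1 : star q = m * star s + star r := by
          rw [hqr, star_add, star_mul, star_natCast, (Nat.cast_commute m _).eq]
        have h2 : star r = star q - m * star s := by rw [h1]; abel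
        rw [h2, sub_mul, star_mul_self, hq, hw, mul_sub, mul_assoc]
        push_cast
        rw [(Nat.cast_commute p (m : ℍ[ℤ])).eq, (Nat.cast_commute m (star s * q)).eq, mul_assoc]
      have hN := congrArg normSq hrw
      rw [map_mul, map_mul, normSq_star, normSq_natCast, hq] at hN
      have hN' : normSq r * p = m * normSq w := by
        apply mul_right_cancel₀ hm0'
        linear_combination hN
      obtain ⟨k, hk⟩ : (m : ℤ) ∣ normSq r := by
        have hc : IsCoprime (m : ℤ) p := Nat.isCoprime_iff_coprime.2
          (Nat.coprime_of_lt_prime hm0.ne' hmp hp).symm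
        exact hc.dvd_of_dvd_mul_right ⟨_, hN'⟩
      have hk0 : 0 < k := by
        have : 0 < (m : ℤ) * k := hk ▸ lt_of_le_of_ne normSq_nonneg hrne.symm
        exact pos_of_mul_pos_right this (by positivity)
      have hkm : k < m := by
        rw [hk, sq] at hr
        exact lt_of_mul_lt_mul_left hr (by positivity)
      lift k to ℕ using hk0.le
      refine ih k (by omega) (by omega) (by omega) ⟨w, u - star s * t, ?_, ?_⟩
      · rw [hw, sub_mul, mul_assoc, hqt, mul_sub, ← mul_assoc (star s),
          ← mul_assoc (p : ℍ[ℤ]), (Nat.cast_commute p (star s)).eq]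
      · apply mul_left_cancel₀ hm0'
        rw [← hN', hk]; ring

end Quaternion

open Quaternion in
/-- Let `v = (x, y, z)` be an integral vector such that `-(x ^ 2 + y ^ 2 + z ^ 2)` is a nonzero
square modulo `p`. Then some integral quaternion of norm `p` conjugates `v` to an integral
vector. -/
theorem exists_rotation {p : ℕ} (hp : p.Prime) (hp2 : Odd p) {x y z s : ℤ}
    (hs : (p : ℤ) ∣ x ^ 2 + y ^ 2 + z ^ 2 + s ^ 2) (hps : ¬ (p : ℤ) ∣ s) :
    ∃ a b c d X Y Z : ℤ, a ^ 2 + b ^ 2 + c ^ 2 + d ^ 2 = p ∧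
      X ^ 2 + Y ^ 2 + Z ^ 2 = x ^ 2 + y ^ 2 + z ^ 2 ∧
      p * X = (a ^ 2 + b ^ 2 - c ^ 2 - d ^ 2) * x + 2 * (b * c - a * d) * y +
        2 * (b * d + a * c) * z ∧
      p * Y = 2 * (b * c + a * d) * x + (a ^ 2 - b ^ 2 + c ^ 2 - d ^ 2) * y +
        2 * (c * d - a * b) * z ∧
      p * Z = 2 * (b * d - a * c) * x + 2 * (c * d + a * b) * y +
        (a ^ 2 - b ^ 2 - c ^ 2 + d ^ 2) * z := by
  have hp0 : (p : ℤ) ≠ 0 := by exact_mod_cast hp.ne_zero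
  have hpp : (0 : ℤ) < p := by exact_mod_cast hp.pos
  obtain ⟨k, hk⟩ := hs
  have hcast : (p : ℍ[ℤ]) = ((p : ℤ) : ℍ[ℤ]) := by norm_num
  obtain ⟨t, r, htr, hr⟩ := exists_small_residue hp2 (ofCoords s x y z)
  have hr' : r = ofCoords s x y z - p * t := by rw [htr]; abel
  have hdvd : (p : ℤ) ∣ normSq r := by
    obtain ⟨t₁, t₂, t₃, t₄, rfl⟩ : ∃ a b c d, t = ofCoords a b c d :=
      ⟨t.re, t.imI, t.imJ, t.imK, rfl⟩
    rw [hr', hcast, normSq_def']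
    simp
    refine ⟨k + p * (t₁ ^ 2 + t₂ ^ 2 + t₃ ^ 2 + t₄ ^ 2) -
      2 * (s * t₁ + x * t₂ + y * t₃ + z * t₄), ?_⟩
    linear_combination hk
  obtain ⟨m, hm⟩ := hdvd
  have hm0 : 0 < m := by
    have hne : normSq r ≠ 0 := by
      intro h
      apply hps
      rw [normSq_eq_zero.1 h, hcast, add_zero] at htr
      exact ⟨t.re, by simpa using congrArg QuaternionAlgebra.re htr⟩
    have : 0 < (p : ℤ) * m := hm ▸ lt_of_le_of_ne normSq_nonneg hne.symm
    exact pos_of_mul_pos_right this hpp.le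
  have hmp : m < p := by
    rw [hm, sq] at hr
    exact lt_of_mul_lt_mul_left hr hpp.le
  lift m to ℕ using hm0.le
  obtain ⟨q, u, hqt, hq⟩ :=
    exists_normSq_eq_of_small hp hp2 (ofCoords (-s) x y z) m (by omega) (by omega)
      ⟨r, -(k : ℤ) - t * ofCoords (-s) x y z, by
        have : (ofCoords s x y z) * ofCoords (-s) x y z = p * -(k : ℤ) := by
          rw [hcast]
          ext <;> simp <;> linarith
        rw [hr', sub_mul, this, mul_sub, mul_assoc], hm⟩
  obtain ⟨a, b, c, d, rfl⟩ : ∃ a b c d, q = ofCoords a b c d := ⟨q.re, q.imI, q.imJ, q.imK, rfl⟩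
  obtain ⟨t₁, t₂, t₃, t₄, rfl⟩ : ∃ a b c d, u = ofCoords a b c d :=
    ⟨u.re, u.imI, u.imJ, u.imK, rfl⟩
  rw [normSq_def'] at hq
  simp only [re_ofCoords, imI_ofCoords, imJ_ofCoords, imK_ofCoords] at hq
  rw [hcast] at hqt
  have e1 := congrArg QuaternionAlgebra.re hqt
  have e2 := congrArg QuaternionAlgebra.imI hqt
  have e3 := congrArg QuaternionAlgebra.imJ hqt
  have e4 := congrArg QuaternionAlgebra.imK hqt
  simp at e1 e2 e3 e4
  have hX : p * (-t₁ * b + t₂ * a - t₃ * d + t₄ * c) =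
      (a ^ 2 + b ^ 2 - c ^ 2 - d ^ 2) * x + 2 * (b * c - a * d) * y +
        2 * (b * d + a * c) * z := by
    linear_combination b * e1 - a * e2 + d * e3 - c * e4
  have hY : p * (-t₁ * c + t₂ * d + t₃ * a - t₄ * b) =
      2 * (b * c + a * d) * x + (a ^ 2 - b ^ 2 + c ^ 2 - d ^ 2) * y +
        2 * (c * d - a * b) * z := by
    linear_combination c * e1 - d * e2 - a * e3 + b * e4
  have hZ : p * (-t₁ * d - t₂ * c + t₃ * b + t₄ * a) =
      2 * (b * d - a * c) * x + 2 * (c * d + a * b) * y +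
        (a ^ 2 - b ^ 2 - c ^ 2 + d ^ 2) * z := by
    linear_combination d * e1 + c * e2 - b * e3 - a * e4
  refine ⟨a, b, c, d, _, _, _, hq, ?_, hX, hY, hZ⟩
  generalize -t₁ * b + t₂ * a - t₃ * d + t₄ * c = X at *
  generalize -t₁ * c + t₂ * d + t₃ * a - t₄ * b = Y at *
  generalize -t₁ * d - t₂ * c + t₃ * b + t₄ * a = Z at *
  apply mul_left_cancel₀ (pow_ne_zero 2 hp0)
  simp only [mul_add, ← mul_pow]
  rw [hX, hY, hZ, ← hq]
  ring

theorem Int.sq_emod_four (t : ℤ) :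
    (t % 2 = 0 ∧ t ^ 2 % 4 = 0) ∨ (t % 2 = 1 ∧ t ^ 2 % 4 = 1) := by
  rcases Int.even_or_odd' t with ⟨k, rfl | rfl⟩
  · left; ring_nf; omega
  · right; ring_nf; omega

/-- Among four integers whose squares add up to `3` modulo `4`, exactly one is even. -/
theorem Int.odd_of_sum_four_squares_mod_four_eq_three {a b c d : ℤ}
    (h : (a ^ 2 + b ^ 2 + c ^ 2 + d ^ 2) % 4 = 3) :
    (a ^ 2 + b ^ 2 - c ^ 2 - d ^ 2) % 2 = 1 ∧ (b * c + a * d) % 2 = 1 ∧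
      (b * d - a * c) % 2 = 1 := by
  refine ⟨by omega, ?_, ?_⟩
  all_goals
    rcases Int.sq_emod_four a with ha | ha <;> rcases Int.sq_emod_four b with hb | hb <;>
      rcases Int.sq_emod_four c with hc | hc <;> rcases Int.sq_emod_four d with hd | hd <;> first
      | omega
      | simp [Int.add_emod, Int.sub_emod, Int.mul_emod, ha.1, hb.1, hc.1, hd.1]

/-- `m = x ^ 2 + y ^ 2 + z ^ 2` with `x` odd and `y`, `z` congruent to `2` modulo `4`. -/
def HasRep (m : ℤ) : Prop :=
  ∃ x y z : ℤ, x ^ 2 + y ^ 2 + z ^ 2 = m ∧ x % 2 = 1 ∧ y % 4 = 2 ∧ z % 4 = 2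

theorem hasRep_iff (m : ℤ) : HasRep m ↔
    ∃ x y z : ℤ, x ^ 2 + y ^ 2 + z ^ 2 = m ∧ x ≡ 1 [ZMOD 4] ∧ y ≡ 2 [ZMOD 8] ∧ z ≡ 2 [ZMOD 8] := by
  simp only [Int.ModEq]
  constructor
  · rintro ⟨x, y, z, h, hx, hy, hz⟩
    obtain ⟨x', hx', hx4⟩ : ∃ x', x' ^ 2 = x ^ 2 ∧ x' % 4 = 1 % 4 := by
      rcases (by omega : x % 4 = 1 ∨ (-x) % 4 = 1) with h | h
      exacts [⟨x, rfl, h⟩, ⟨-x, neg_sq x, h⟩]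
    have key : ∀ y : ℤ, y % 4 = 2 → ∃ y', y' ^ 2 = y ^ 2 ∧ y' % 8 = 2 % 8 := by
      intro y hy
      rcases (by omega : y % 8 = 2 ∨ (-y) % 8 = 2) with h | h
      exacts [⟨y, rfl, h⟩, ⟨-y, neg_sq y, h⟩]
    obtain ⟨y', hy', hy8⟩ := key y hy
    obtain ⟨z', hz', hz8⟩ := key z hz
    exact ⟨x', y', z', by rw [hx', hy', hz', h], hx4, hy8, hz8⟩
  · rintro ⟨x, y, z, h, hx, hy, hz⟩
    exact ⟨x, y, z, h, by omega, by omega, by omega⟩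

theorem hasRep_sq_of_prime_dvd {M p : ℕ} (hM : M % 2 = 1) (hp4 : p % 4 = 3)
    (hpM : p ∣ M) : HasRep ((M : ℤ) ^ 2) := by
  obtain ⟨m, rfl⟩ := hpM
  obtain ⟨a, b, c, d, h⟩ := Nat.sum_four_squares p
  have h' : (a ^ 2 + b ^ 2 + c ^ 2 + d ^ 2 : ℤ) = p := by exact_mod_cast h
  obtain ⟨hX, hY, hZ⟩ := Int.odd_of_sum_four_squares_mod_four_eq_three
    (a := a) (b := b) (c := c) (d := d) (by rw [h']; omega)
  have hm : (m : ℤ) % 2 = 1 := by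
    have := (Nat.odd_mul.1 (Nat.odd_iff.2 hM)).2
    have := Nat.odd_iff.1 this
    omega
  refine ⟨(a ^ 2 + b ^ 2 - c ^ 2 - d ^ 2) * m, 2 * ((b * c + a * d) * m),
    2 * ((b * d - a * c) * m), ?_, ?_, ?_, ?_⟩
  · push_cast
    rw [← h']; ring
  · rw [Int.mul_emod, hX, hm]; rfl
  · have : ((b * c + a * d : ℤ) * m) % 2 = 1 := by rw [Int.mul_emod, hY, hm]; rfl
    omega
  · have : ((b * d - a * c : ℤ) * m) % 2 = 1 := by rw [Int.mul_emod, hZ, hm]; rfl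
    omega

open NumberTheorySymbols in
theorem hasRep_of_not_isSquare {N : ℕ} (h8 : N % 8 = 1) (hN : ¬ IsSquare N) : HasRep N := by
  have hN1 : 1 < N := by
    by_contra h
    have : N = 1 := by omega
    exact hN (this ▸ IsSquare.one)
  -- a representation with `x` odd and `y`, `z` even
  obtain ⟨x, y, z, h, hx, hy, hz⟩ : ∃ x y z : ℤ, (N : ℤ) = x ^ 2 + y ^ 2 + z ^ 2 ∧
      x % 2 = 1 ∧ y % 2 = 0 ∧ z % 2 = 0 := by
    obtain ⟨x, y, z, h⟩ := sum_three_squares_of_mod_eight_eq_one h8 hN1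
    rcases Int.sq_emod_four x with hx | hx <;> rcases Int.sq_emod_four y with hy | hy <;>
      rcases Int.sq_emod_four z with hz | hz <;>
      first
      | omega
      | exact ⟨x, y, z, h, hx.1, hy.1, hz.1⟩
      | exact ⟨y, x, z, by rw [h]; ring, hy.1, hx.1, hz.1⟩
      | exact ⟨z, x, y, by rw [h]; ring, hz.1, hx.1, hy.1⟩
  obtain ⟨y', rfl⟩ := Int.dvd_of_emod_eq_zero hy
  obtain ⟨z', rfl⟩ := Int.dvd_of_emod_eq_zero hz
  have hpar : (y' % 2 = 0 ∧ z' % 2 = 0) ∨ (y' % 2 = 1 ∧ z' % 2 = 1) := by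
    obtain ⟨k, rfl⟩ := Int.odd_iff.2 hx
    obtain ⟨l, hl⟩ := Int.even_mul_succ_self k
    have h1 : (2 * k + 1) ^ 2 = 8 * l + 1 := by linear_combination 4 * hl
    rw [h1] at h
    have h2 : (y' ^ 2 + z' ^ 2) % 2 = 0 := by ring_nf at h ⊢; omega
    rw [← Int.even_iff, Int.even_add, Int.even_pow' two_ne_zero, Int.even_pow' two_ne_zero,
      Int.even_iff, Int.even_iff] at h2
    omega
  rcases hpar with ⟨hy', hz'⟩ | ⟨hy', hz'⟩
  swap
  · exact ⟨x, 2 * y', 2 * z', h.symm, hx, by omega, by omega⟩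
  obtain ⟨p, hp, hp4, hJ⟩ := exists_prime_three_mod_four_jacobiSym_eq_neg_one (by omega) hN
  have := Fact.mk hp
  have hpodd : Odd p := Nat.odd_iff.2 (by omega)
  have hJ' : J(-(N : ℤ) | p) = 1 := by
    rw [jacobiSym.neg _ hpodd, hJ, ZMod.χ₄_nat_three_mod_four hp4]; norm_num
  obtain ⟨s, hs⟩ := exists_dvd_sq_add_of_jacobiSym_eq_one hJ'
  rw [add_comm] at hs
  have hps : ¬ (p : ℤ) ∣ s := by
    intro hd
    have h1 : (p : ℤ) ∣ N := (dvd_add_left (dvd_pow hd two_ne_zero)).1 hs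
    have h2 : J((N : ℤ) | p) = 0 := by
      rw [← jacobiSym.legendreSym.to_jacobiSym, legendreSym.eq_zero_iff,
        ZMod.intCast_zmod_eq_zero_iff_dvd]
      exact h1
    rw [h2] at hJ
    norm_num at hJ
  rw [h] at hs
  obtain ⟨a, b, c, d, X, Y, Z, hq, hXYZ, hX, hY, hZ⟩ := exists_rotation hp hpodd hs hps
  obtain ⟨hA, hB, hC⟩ := Int.odd_of_sum_four_squares_mod_four_eq_three
    (a := a) (b := b) (c := c) (d := d) (by rw [hq]; omega)
  obtain ⟨y, rfl⟩ := Int.dvd_of_emod_eq_zero hy'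
  obtain ⟨z, rfl⟩ := Int.dvd_of_emod_eq_zero hz'
  have hAx : ((a ^ 2 + b ^ 2 - c ^ 2 - d ^ 2) * x) % 2 = 1 := by rw [Int.mul_emod, hA, hx]; rfl
  have hBx : ((b * c + a * d) * x) % 2 = 1 := by rw [Int.mul_emod, hB, hx]; rfl
  have hCx : ((b * d - a * c) * x) % 2 = 1 := by rw [Int.mul_emod, hC, hx]; rfl
  obtain ⟨j, hj⟩ : ∃ j : ℤ, (p : ℤ) = 4 * j - 1 := ⟨(p + 1) / 4, by omega⟩
  rw [hj] at hX hY hZ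
  refine ⟨X, Y, Z, hXYZ.trans h.symm, ?_, ?_, ?_⟩
  · have : X = (a ^ 2 + b ^ 2 - c ^ 2 - d ^ 2) * x + 2 * (2 * j * X -
        (a ^ 2 + b ^ 2 - c ^ 2 - d ^ 2) * x - (4 * (b * c - a * d) * y + 4 * (b * d + a * c) * z)) := by
      linear_combination -hX
    omega
  · have : Y = 2 * ((b * c + a * d) * x) + 4 * (j * Y - (b * c + a * d) * x -
        ((a ^ 2 - b ^ 2 + c ^ 2 - d ^ 2) * y + 2 * (c * d - a * b) * z)) := by
      linear_combination -hY
    omega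
  · have : Z = 2 * ((b * d - a * c) * x) + 4 * (j * Z - (b * d - a * c) * x -
        (2 * (c * d + a * b) * y + (a ^ 2 - b ^ 2 - c ^ 2 + d ^ 2) * z)) := by
      linear_combination -hZ
    omega

/-- A number with only prime factors `1` mod `4` is `1` mod `4`. -/
theorem Nat.mod_four_eq_one_of_forall_prime_dvd {M : ℕ} (hM0 : M ≠ 0)
    (hM : ∀ p : ℕ, p.Prime → p ∣ M → p % 4 = 1) : M % 4 = 1 := by
  induction M using Nat.recOnMul with
  | zero => exact absurd rfl hM0
  | one => rfl
  | prime p hp => exact hM p hp dvd_rfl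
  | mul a b iha ihb =>
    have ha := iha (left_ne_zero_of_mul hM0) fun p hp h => hM p hp (h.mul_right b)
    have hb := ihb (right_ne_zero_of_mul hM0) fun p hp h => hM p hp (h.mul_left a)
    rw [Nat.mul_mod, ha, hb]

theorem Nat.exists_sq_add_sq_of_mul_eq {A B u v M : ℕ} (hA : A ≠ 0) (hB : B ≠ 0)
    (h : A * B = u ^ 2 + v ^ 2) (hAB : A + B = 2 * M)
    (hM : ∀ p : ℕ, p.Prime → p ∣ M → p % 4 = 1) : ∃ a b, A = a ^ 2 + b ^ 2 := by
  rw [Nat.eq_sq_add_sq_iff]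
  intro q hq hq4
  have hqp := Nat.prime_of_mem_primeFactors hq
  have := Fact.mk hqp
  have hqA := Nat.dvd_of_mem_primeFactors hq
  have hqB : ¬ q ∣ B := by
    intro hqB
    have h1 : q ∣ 2 * M := hAB ▸ dvd_add hqA hqB
    rcases (hqp.dvd_mul).1 h1 with h2 | h2
    · have := Nat.le_of_dvd two_pos h2
      omega
    · have := hM q hqp h2
      omega
  have h1 := (Nat.eq_sq_add_sq_iff.1 ⟨u, v, h⟩) q
    (Nat.mem_primeFactors.2 ⟨hqp, hqA.mul_right B, mul_ne_zero hA hB⟩) hq4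
  rwa [padicValNat.mul hA hB, padicValNat.eq_zero_of_not_dvd hqB, add_zero] at h1

theorem not_hasRep_sq {M : ℕ} (hM0 : M ≠ 0) (hM : ∀ p : ℕ, p.Prime → p ∣ M → p % 4 = 1) :
    ¬ HasRep ((M : ℤ) ^ 2) := by
  rintro ⟨x, y, z, h, hx, hy, hz⟩
  have hM4 := Nat.mod_four_eq_one_of_forall_prime_dvd hM0 hM
  have hy0 : 0 < y ^ 2 := by
    have : y ≠ 0 := by rintro rfl; norm_num at hy
    positivity
  have hlt := abs_lt_of_sq_lt_sq (by linarith [sq_nonneg z] : x ^ 2 < (M : ℤ) ^ 2) (by positivity)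
  obtain ⟨hl, hr⟩ := abs_lt.1 hlt
  have hprod : ((M : ℤ) - x) * (M + x) = y ^ 2 + z ^ 2 := by linear_combination -h
  obtain ⟨A, hA⟩ : ∃ A : ℕ, (A : ℤ) = M - x := ⟨(M - x).toNat, by omega⟩
  obtain ⟨B, hB⟩ : ∃ B : ℕ, (B : ℤ) = M + x := ⟨(M + x).toNat, by omega⟩
  have hAB : A * B = y.natAbs ^ 2 + z.natAbs ^ 2 := by
    zify
    rw [hA, hB, hprod, sq_abs, sq_abs]
  have hsum : A + B = 2 * M := by omega
  obtain ⟨a, b, hab⟩ := Nat.exists_sq_add_sq_of_mul_eq (by omega) (by omega) hAB hsum hM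
  obtain ⟨c, d, hcd⟩ := Nat.exists_sq_add_sq_of_mul_eq (by omega) (by omega)
    ((mul_comm B A).trans hAB) ((add_comm B A).trans hsum) hM
  have h16 : (A * B) % 16 = 8 := by
    have e1 : ∀ t : ℤ, t % 4 = 2 → t ^ 2 % 16 = 4 := by
      intro t ht
      obtain ⟨k, rfl⟩ : ∃ k, t = 4 * k + 2 := ⟨t / 4, by omega⟩
      ring_nf; omega
    have := e1 y hy
    have := e1 z hz
    have : ((A * B : ℕ) : ℤ) = y ^ 2 + z ^ 2 := by push_cast; rw [hA, hB, hprod]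
    omega
  have sq16 : ∀ t : ℕ, t ^ 2 % 16 = 0 ∨ t ^ 2 % 16 = 1 ∨ t ^ 2 % 16 = 4 ∨ t ^ 2 % 16 = 9 := by
    intro t
    rw [Nat.pow_mod]
    have := Nat.mod_lt t (by norm_num : 0 < 16)
    interval_cases t % 16 <;> simp
  have hA16 : A % 16 = 2 ∨ A % 16 = 10 ∨ A % 16 = 4 ∨ A % 16 = 8 ∨ A % 16 = 0 ∨ A % 2 = 1 := by
    have := sq16 a; have := sq16 b; omega
  have hB16 : B % 16 = 2 ∨ B % 16 = 10 ∨ B % 16 = 4 ∨ B % 16 = 8 ∨ B % 16 = 0 ∨ B % 2 = 1 := by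
    have := sq16 c; have := sq16 d; omega
  have hAe : A % 2 = 0 := by omega
  have hBe : B % 2 = 0 := by omega
  rw [Nat.mul_mod] at h16
  have h8 : (A % 16 + B % 16) % 8 = 2 := by omega
  rcases hA16 with h1 | h1 | h1 | h1 | h1 | h1 <;> rcases hB16 with h2 | h2 | h2 | h2 | h2 | h2 <;>
    first | omega | (rw [h1, h2] at h16 h8; omega)

theorem stmt_11 (n : ℕ) (hn : 0 < n) :
    Nat.card {v : ℤ × ℤ × ℤ //
        v.1 ^ 2 + v.2.1 ^ 2 + v.2.2 ^ 2 = 8 * (n : ℤ) + 1 ∧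
        v.1 ≡ 1 [ZMOD 4] ∧ v.2.1 ≡ 2 [ZMOD 8] ∧ v.2.2 ≡ 2 [ZMOD 8]} = 0 ↔
      ∃ M : ℕ, 0 < M ∧ 8 * n + 1 = M ^ 2 ∧ ∀ p : ℕ, p.Prime → p ∣ M → p % 4 = 1 := by
  have hfin : Finite {v : ℤ × ℤ × ℤ //
        v.1 ^ 2 + v.2.1 ^ 2 + v.2.2 ^ 2 = 8 * (n : ℤ) + 1 ∧
        v.1 ≡ 1 [ZMOD 4] ∧ v.2.1 ≡ 2 [ZMOD 8] ∧ v.2.2 ≡ 2 [ZMOD 8]} := by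
    have hbound : ∀ t m : ℤ, t ^ 2 ≤ m → t ∈ Set.Icc (-m) m := fun t m h =>
      ⟨by nlinarith [sq_nonneg (t + 1)], by nlinarith [sq_nonneg (t - 1)]⟩
    refine ((Set.finite_Icc (-(8 * (n : ℤ) + 1)) (8 * n + 1)).prod
      ((Set.finite_Icc (-(8 * (n : ℤ) + 1)) (8 * n + 1)).prod
      (Set.finite_Icc (-(8 * (n : ℤ) + 1)) (8 * n + 1)))).subset ?_ |>.to_subtype
    rintro ⟨x, y, z⟩ ⟨h, -⟩
    dsimp only at h
    exact ⟨hbound _ _ (by linarith [sq_nonneg y, sq_nonneg z]),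
      hbound _ _ (by linarith [sq_nonneg x, sq_nonneg z]),
      hbound _ _ (by linarith [sq_nonneg x, sq_nonneg y])⟩
  have hcard : Nat.card {v : ℤ × ℤ × ℤ //
        v.1 ^ 2 + v.2.1 ^ 2 + v.2.2 ^ 2 = 8 * (n : ℤ) + 1 ∧
        v.1 ≡ 1 [ZMOD 4] ∧ v.2.1 ≡ 2 [ZMOD 8] ∧ v.2.2 ≡ 2 [ZMOD 8]} = 0 ↔
      ¬ HasRep ((8 * n + 1 : ℕ) : ℤ) := by
    rw [Finite.card_eq_zero_iff, hasRep_iff, ← not_nonempty_iff, nonempty_subtype]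
    simp only [Prod.exists]
    push_cast
    rfl
  rw [hcard]
  constructor
  · intro h
    by_cases hsq : IsSquare (8 * n + 1)
    · obtain ⟨M, hM⟩ := hsq
      rw [← sq] at hM
      have hodd : M % 2 = 1 := by
        have : Odd (M ^ 2) := hM ▸ Nat.odd_iff.2 (by omega)
        exact Nat.odd_iff.1 ((Nat.odd_pow_iff two_ne_zero).1 this)
      refine ⟨M, by omega, hM, fun p hp hpM => ?_⟩
      have hpodd : p % 2 = 1 := Nat.odd_iff.1 ((Nat.odd_iff.2 hodd).of_dvd_nat hpM)
      by_contra hp1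
      apply h
      rw [hM, Nat.cast_pow]
      exact hasRep_sq_of_prime_dvd hodd (by omega) hpM
    · exact absurd (hasRep_of_not_isSquare (by omega) hsq) h
  · rintro ⟨M, hM0, hM, hMp⟩
    rw [hM, Nat.cast_pow]
    exact not_hasRep_sq hM0.ne' hMp
end

section
/- Let n be a positive integer. Then the number of (x,y,z) ∈ ℤ³ with x²+y²+2z² = 8n+1, x ≡ 1 (mod 4), y ≡ 4 (mod 16), and z ≡ 0 (mod 2) is zero if and only if 8n+1 = E² for some positive integer E all of whose prime divisors are congruent to 1 or 3 modulo 8. -/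
theorem exists_balanced_remainder (a b : ℤ) (ha : 0 < a) :
    ∃ k r : ℤ, b = a * k + r ∧ -a ≤ 2 * r ∧ 2 * r ≤ a := by
  refine ⟨(2 * b + a) / (2 * a), b - a * ((2 * b + a) / (2 * a)), by ring, ?_, ?_⟩
  · have := Int.mul_ediv_self_le (x := 2 * b + a) (k := 2 * a) (by omega)
    linarith
  · have := Int.lt_mul_ediv_self_add (x := 2 * b + a) (k := 2 * a) (by omega)
    linarith

theorem binary_form_eq_sq_add_mul_sq (D : ℤ) (hD : D = 1 ∨ D = 2) (a b c x y : ℤ) (ha : 0 < a)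
    (h : a * c - b ^ 2 = D) :
    ∃ p q : ℤ, a * x ^ 2 + 2 * b * x * y + c * y ^ 2 = p ^ 2 + D * q ^ 2 := by
  obtain ⟨k, r, hb, hr1, hr2⟩ := exists_balanced_remainder a b ha
  have hdet : a * (c - 2 * b * k + a * k ^ 2) - r ^ 2 = D := by subst hb; linarith
  have hD0 : 0 < D ∧ D ≤ 2 := by omega
  by_cases hlt : c - 2 * b * k + a * k ^ 2 < a
  · have hpos : 0 < c - 2 * b * k + a * k ^ 2 := by
      by_contra! hneg
      nlinarith [sq_nonneg r]
    obtain ⟨p, q, hpq⟩ := binary_form_eq_sq_add_mul_sq D hD (c - 2 * b * k + a * k ^ 2) r a y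
      (x + k * y) hpos (by linarith)
    exact ⟨p, q, by rw [← hpq]; subst hb; ring⟩
  · have ha1 : a = 1 := by
      by_contra hne
      have h1 : a ^ 2 ≤ a * (c - 2 * b * k + a * k ^ 2) := by nlinarith
      have h2 : 4 * r ^ 2 ≤ a ^ 2 := by nlinarith
      have h3 : 2 ≤ a := by omega
      nlinarith
    have hr : r = 0 := by omega
    refine ⟨x + k * y, y, ?_⟩
    rw [← hdet, hr, hb, ha1, hr]
    ring
termination_by a.toNat
decreasing_by omega

theorem ternary_form_eq_sum_three_sq (a b c d e f x y z : ℤ) (ha : 0 < a)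
    (hG : 0 < a * b - d ^ 2)
    (h : a * b * c + 2 * d * e * f - a * f ^ 2 - b * e ^ 2 - c * d ^ 2 = 1) :
    ∃ p q r : ℤ, a * x ^ 2 + b * y ^ 2 + c * z ^ 2 + 2 * d * x * y + 2 * e * x * z +
      2 * f * y * z = p ^ 2 + q ^ 2 + r ^ 2 := by
  obtain ⟨k, r, hk, hr1, hr2⟩ := exists_balanced_remainder (a * b - d ^ 2) (a * f - d * e) hG
  have hg : (a * b - d ^ 2) * (a * (c + b * k ^ 2 - 2 * f * k) - (e - d * k) ^ 2) - r ^ 2 = a := by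
    have : r = a * f - d * e - (a * b - d ^ 2) * k := by linarith
    rw [this]
    linear_combination a * h
  by_cases hlt : a * (c + b * k ^ 2 - 2 * f * k) - (e - d * k) ^ 2 < a * b - d ^ 2
  · have hpos : 0 < a * (c + b * k ^ 2 - 2 * f * k) - (e - d * k) ^ 2 := by
      by_contra! hneg
      nlinarith [sq_nonneg r]
    obtain ⟨p, q, s, hpqs⟩ := ternary_form_eq_sum_three_sq a (c + b * k ^ 2 - 2 * f * k) b
      (e - d * k) d (f - b * k) x z (y + k * z) ha hpos (by linarith)
    exact ⟨p, q, s, by rw [← hpqs]; ring⟩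
  · obtain ⟨l, t, hl, ht1, ht2⟩ := exists_balanced_remainder a d ha
    have hG' : a * (b + a * l ^ 2 - 2 * d * l) = t ^ 2 + (a * b - d ^ 2) := by
      have : t = d - a * l := by linarith
      rw [this]; ring
    by_cases hlt' : b + a * l ^ 2 - 2 * d * l < a
    · have hpos : 0 < b + a * l ^ 2 - 2 * d * l := by
        by_contra! hneg
        nlinarith [sq_nonneg t]
      obtain ⟨p, q, s, hpqs⟩ := ternary_form_eq_sum_three_sq (b + a * l ^ 2 - 2 * d * l) a c
        (d - a * l) (f - e * l) e y (x + l * y) z hpos (by linarith) (by linarith)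
      exact ⟨p, q, s, by rw [← hpqs]; ring⟩
    · have h1 : 3 * a ^ 2 ≤ 4 * (a * b - d ^ 2) := by nlinarith
      have h2 : 3 * (a * b - d ^ 2) ^ 2 ≤ 4 * a := by nlinarith
      have ha1 : a = 1 := by
        generalize a * b - d ^ 2 = G at *
        by_contra hne
        have : 2 ≤ a := by omega
        nlinarith
      subst ha1
      obtain ⟨p, q, hpq⟩ := binary_form_eq_sq_add_mul_sq 1 (Or.inl rfl) (1 * b - d ^ 2)
        (1 * f - d * e) (c - e ^ 2) y z hG (by linarith)
      exact ⟨x + d * y + e * z, p, q, by linear_combination hpq⟩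
termination_by (a.toNat, (a * b - d ^ 2).toNat)
decreasing_by
  · apply Prod.Lex.right; omega
  · apply Prod.Lex.left; omega

theorem exists_sum_three_sq_of_mod_four_eq_two (n : ℕ) (hn : n % 4 = 2) :
    ∃ x y z : ℤ, (n : ℤ) = x ^ 2 + y ^ 2 + z ^ 2 := by
  have hcop : (n - 1).Coprime (4 * n) := by
    have h1 : (n - 1).Coprime n := by
      obtain ⟨k, rfl⟩ : ∃ k, n = k + 1 := ⟨n - 1, by omega⟩
      simp
    refine Nat.Coprime.mul_right ?_ h1
    exact (Nat.coprime_pow_right_iff (by norm_num : 0 < 2) _ 2).2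
      ((Nat.coprime_two_right).2 ⟨n / 2 - 1, by omega⟩)
  obtain ⟨p, hpn, hp, hmod⟩ := Nat.forall_exists_prime_gt_and_modEq n (by omega : 4 * n ≠ 0) hcop
  have := Fact.mk hp
  obtain ⟨j, hj⟩ := (Nat.modEq_iff_dvd' (by omega : n - 1 ≤ p)).1 hmod.symm
  have hpj : p + 1 = (4 * j + 1) * n := by
    have : p = 4 * n * j + (n - 1) := by omega
    rw [this]
    have : n - 1 + 1 = n := by omega
    linarith
  have hpodd : p % 2 = 1 := by
    rcases hp.eq_two_or_odd with h | h
    · omega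
    · exact h
  have hpodd4 : p % 4 = 1 := by
    have : (p + 1) % 4 = 2 := by
      rw [hpj, Nat.mul_mod, hn]; omega
    omega
  have hJ : jacobiSym (-((4 * j + 1 : ℕ) : ℤ)) p = 1 := by
    rw [jacobiSym.neg _ (Nat.odd_iff.2 hpodd), ZMod.χ₄_nat_one_mod_four hpodd4, one_mul,
      jacobiSym.quadratic_reciprocity_one_mod_four (by omega) (Nat.odd_iff.2 hpodd)]
    have : jacobiSym (p : ℤ) (4 * j + 1) = jacobiSym (-1) (4 * j + 1) := by
      apply jacobiSym.mod_left'
      apply Int.emod_emod_of_dvd _ (dvd_refl _) |>.symm.trans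
      rw [Int.emod_emod_of_dvd _ (dvd_refl _)]
      apply Int.ModEq.symm
      rw [Int.modEq_iff_dvd]
      exact ⟨n, by push_cast; linarith [(by exact_mod_cast hpj : (p : ℤ) + 1 = (4 * j + 1) * n)]⟩
    rw [this, jacobiSym.at_neg_one (Nat.odd_iff.2 (by omega)),
      ZMod.χ₄_nat_one_mod_four (by omega)]
  obtain ⟨b, hb⟩ := ZMod.isSquare_of_jacobiSym_eq_one hJ
  obtain ⟨b, rfl⟩ := ZMod.intCast_surjective b
  obtain ⟨a, ha⟩ : (p : ℤ) ∣ b ^ 2 + (4 * j + 1) := by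
    rw [← ZMod.intCast_zmod_eq_zero_iff_dvd]
    push_cast at hb ⊢
    linear_combination -hb
  have hp0 : (0 : ℤ) < p := by exact_mod_cast hp.pos
  have hpj' : (p : ℤ) + 1 = (4 * j + 1) * n := by exact_mod_cast hpj
  have ha0 : 0 < a := by
    have : 0 < (p : ℤ) * a := by rw [← ha]; positivity
    exact pos_of_mul_pos_right this hp0.le
  obtain ⟨x, y, z, hxyz⟩ := ternary_form_eq_sum_three_sq a p n b 1 0 0 0 1 ha0
    (by have : a * p - b ^ 2 = 4 * j + 1 := by linarith
        rw [this]; positivity) (by linear_combination (-n : ℤ) * ha - hpj')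
  exact ⟨x, y, z, by linarith⟩

open ZMod ArithmeticFunction in
/-- The Dirichlet character attached to `ℚ(√-2)`, as an arithmetic function. -/
def charNegTwo : ArithmeticFunction ℤ := ⟨fun n => χ₈' n, by decide⟩

open ZMod

theorem charNegTwo_apply (n : ℕ) : charNegTwo n = χ₈' n := rfl

theorem isMultiplicative_charNegTwo : charNegTwo.IsMultiplicative :=
  ⟨by simp [charNegTwo_apply], fun _ => by
    simp only [charNegTwo_apply, Nat.cast_mul, map_mul]⟩

/-- The divisor sum `∑ d ∣ n, χ d`, half the number of representations of `n` by `x² + 2y²`. -/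
noncomputable def sumCharNegTwo : ArithmeticFunction ℤ :=
  (ArithmeticFunction.zeta : ArithmeticFunction ℤ) * charNegTwo

theorem sumCharNegTwo_apply (n : ℕ) : sumCharNegTwo n = ∑ d ∈ n.divisors, χ₈' (d : ZMod 8) := by
  rw [sumCharNegTwo, ArithmeticFunction.coe_zeta_mul_apply]
  rfl

theorem isMultiplicative_sumCharNegTwo : sumCharNegTwo.IsMultiplicative :=
  ArithmeticFunction.isMultiplicative_zeta.natCast.mul isMultiplicative_charNegTwo

theorem sumCharNegTwo_prime_pow {p : ℕ} (hp : p.Prime) (k : ℕ) :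
    0 ≤ sumCharNegTwo (p ^ k) ∧ (0 < sumCharNegTwo (p ^ k) ↔ (χ₈' (p : ZMod 8) = -1 → Even k)) := by
  have h : sumCharNegTwo (p ^ k) = ∑ i ∈ Finset.range (k + 1), χ₈' (p : ZMod 8) ^ i := by
    rw [sumCharNegTwo_apply, Nat.sum_divisors_prime_pow hp]
    simp only [Nat.cast_pow, map_pow]
  rw [h]
  rcases isQuadratic_χ₈' (p : ZMod 8) with h | h | h <;> rw [h]
  · simp [Finset.sum_range_succ']
  · simp only [one_pow, Finset.sum_const, Finset.card_range, nsmul_eq_mul, mul_one]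
    refine ⟨by positivity, fun _ h => absurd h (by norm_num), fun _ => by positivity⟩
  · rw [neg_one_geom_sum]
    by_cases hk : Even k
    · simp [hk, Nat.even_add_one]
    · simp [hk, Nat.even_add_one]

theorem sumCharNegTwo_nonneg (n : ℕ) : 0 ≤ sumCharNegTwo n := by
  rcases eq_or_ne n 0 with rfl | hn
  · simp
  rw [isMultiplicative_sumCharNegTwo.multiplicative_factorization _ hn]
  exact Finset.prod_nonneg fun p hp =>
    (sumCharNegTwo_prime_pow (Nat.prime_of_mem_primeFactors hp) _).1

theorem sumCharNegTwo_pos_iff {n : ℕ} (hn : n ≠ 0) : 0 < sumCharNegTwo n ↔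
    ∀ p : ℕ, p.Prime → χ₈' (p : ZMod 8) = -1 → Even (n.factorization p) := by
  rw [isMultiplicative_sumCharNegTwo.multiplicative_factorization _ hn]
  constructor
  · intro h p hp hχ
    by_cases hpn : p ∈ n.primeFactors
    · refine (sumCharNegTwo_prime_pow hp _).2.1 ?_ hχ
      refine lt_of_le_of_ne (sumCharNegTwo_prime_pow hp _).1 fun h0 => h.ne' ?_
      exact Finset.prod_eq_zero (i := p) hpn h0.symm
    · rw [← Nat.support_factorization, Finsupp.notMem_support_iff] at hpn
      simp [hpn]
  · intro h
    refine Finset.prod_pos fun p hp => ?_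
    have hp := Nat.prime_of_mem_primeFactors hp
    exact (sumCharNegTwo_prime_pow hp _).2.2 (h p hp)

theorem prime_dvd_of_dvd_sq_add_two_mul_sq {p : ℕ} (hp : p.Prime) (hχ : χ₈' (p : ZMod 8) = -1)
    {x y : ℤ} (h : (p : ℤ) ∣ x ^ 2 + 2 * y ^ 2) : (p : ℤ) ∣ x ∧ (p : ℤ) ∣ y := by
  have := Fact.mk hp
  have hodd : Odd p := by
    refine hp.odd_of_ne_two ?_
    rintro rfl
    exact absurd hχ (by decide)
  refine jacobiSym.prime_dvd_of_eq_neg_one (a := -2) ?_ (by ring_nf at h ⊢; exact h)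
  rw [jacobiSym.at_neg_two hodd, hχ]

theorem prime_eq_sq_add_two_mul_sq {p : ℕ} (hp : p.Prime) (hχ : χ₈' (p : ZMod 8) ≠ -1) :
    ∃ x y : ℤ, (p : ℤ) = x ^ 2 + 2 * y ^ 2 := by
  have := Fact.mk hp
  rcases hp.eq_two_or_odd' with rfl | hodd
  · exact ⟨0, 1, by norm_num⟩
  have h1 : jacobiSym (-2) p = 1 := by
    rw [jacobiSym.at_neg_two hodd]
    rcases isQuadratic_χ₈' (p : ZMod 8) with h | h | h
    · rw [χ₈'_nat_eq_if_mod_eight] at h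
      have := Nat.odd_iff.1 hodd
      split_ifs at h <;> omega
    · exact h
    · exact absurd h hχ
  obtain ⟨b, hb⟩ := ZMod.isSquare_of_jacobiSym_eq_one h1
  obtain ⟨b, rfl⟩ := ZMod.intCast_surjective b
  obtain ⟨a, ha⟩ : (p : ℤ) ∣ b ^ 2 + 2 := by
    rw [← ZMod.intCast_zmod_eq_zero_iff_dvd]
    push_cast at hb ⊢
    linear_combination -hb
  obtain ⟨x, y, hxy⟩ := binary_form_eq_sq_add_mul_sq 2 (Or.inr rfl) p b a 1 0
    (by exact_mod_cast hp.pos) (by linarith)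
  exact ⟨x, y, by linarith⟩

theorem eq_sq_add_two_mul_sq_iff {n : ℕ} (hn : n ≠ 0) :
    (∃ x y : ℤ, (n : ℤ) = x ^ 2 + 2 * y ^ 2) ↔
    ∀ p : ℕ, p.Prime → χ₈' (p : ZMod 8) = -1 → Even (n.factorization p) := by
  induction n using Nat.strong_induction_on with
  | _ n ih =>
  constructor
  · rintro ⟨x, y, hxy⟩ p hp hχ
    by_cases hpn : p ∣ n
    · obtain ⟨⟨x', rfl⟩, ⟨y', rfl⟩⟩ := prime_dvd_of_dvd_sq_add_two_mul_sq hp hχ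
        (hxy ▸ Int.natCast_dvd_natCast.2 hpn)
      have hp0 : (p : ℤ) ^ 2 ≠ 0 := by have := hp.ne_zero; positivity
      obtain ⟨k, hk⟩ : p ^ 2 ∣ n := by
        rw [← Int.natCast_dvd_natCast]
        exact ⟨x' ^ 2 + 2 * y' ^ 2, by rw [hxy]; push_cast; ring⟩
      have hk0 : k ≠ 0 := by rintro rfl; simp at hk; omega
      have hlt : k < n := by
        rw [hk]
        exact lt_mul_of_one_lt_left (Nat.pos_of_ne_zero hk0) (Nat.one_lt_pow two_ne_zero hp.one_lt)
      have hev := (ih k hlt hk0).1 ⟨x', y', by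
        apply mul_left_cancel₀ hp0
        have : ((p ^ 2 * k : ℕ) : ℤ) = n := by rw [hk]
        push_cast at this
        rw [this, hxy]; ring⟩ p hp hχ
      rw [hk, Nat.factorization_mul (by have := hp.ne_zero; positivity) hk0, hp.factorization_pow]
      simpa [Nat.even_add] using hev
    · simp [Nat.factorization_eq_zero_of_not_dvd hpn]
  · intro h
    rcases eq_or_ne n 1 with rfl | h1
    · exact ⟨1, 0, by norm_num⟩
    have hp := Nat.minFac_prime h1
    have hpn := Nat.minFac_dvd n
    generalize n.minFac = p at hp hpn
    by_cases hχ : χ₈' (p : ZMod 8) = -1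
    · have hsq : p ^ 2 ∣ n := by
        rw [hp.pow_dvd_iff_le_factorization hn]
        have h2 := h p hp hχ
        have h3 := hp.factorization_pos_of_dvd hn hpn
        obtain ⟨t, ht⟩ := h2
        omega
      obtain ⟨k, rfl⟩ := hsq
      have hk0 : k ≠ 0 := by rintro rfl; simp at hn
      have hlt : k < p ^ 2 * k :=
        lt_mul_of_one_lt_left (Nat.pos_of_ne_zero hk0) (Nat.one_lt_pow two_ne_zero hp.one_lt)
      obtain ⟨x, y, hxy⟩ := (ih k hlt hk0).2 fun q hq hq' => by
        have := h q hq hq'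
        rw [Nat.factorization_mul (by have := hp.ne_zero; positivity) hk0, hp.factorization_pow] at this
        by_cases hqp : p = q
        · subst hqp
          simpa [Nat.even_add] using this
        · simpa [hqp] using this
      exact ⟨p * x, p * y, by push_cast; rw [hxy]; ring⟩
    · obtain ⟨k, rfl⟩ := hpn
      have hk0 : k ≠ 0 := by rintro rfl; simp at hn
      have hlt : k < p * k := lt_mul_of_one_lt_left (Nat.pos_of_ne_zero hk0) hp.one_lt
      obtain ⟨x, y, hxy⟩ := (ih k hlt hk0).2 fun q hq hq' => by
        have := h q hq hq'
        have hqp : p ≠ q := by rintro rfl; exact hχ hq'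
        rw [Nat.factorization_mul hp.ne_zero hk0, hp.factorization] at this
        simpa [hqp] using this
      obtain ⟨u, v, huv⟩ := prime_eq_sq_add_two_mul_sq hp hχ
      exact ⟨u * x - 2 * v * y, u * y + v * x, by push_cast; rw [hxy, huv]; ring⟩

theorem χ₈'_int_neg (s : ℤ) : χ₈' ((-s : ℤ) : ZMod 8) = -χ₈' (s : ZMod 8) := by
  rw [χ₈'_int_eq_if_mod_eight, χ₈'_int_eq_if_mod_eight]
  split_ifs <;> omega

theorem χ₈'_int_add_four_mul (t u : ℤ) (ht : t % 2 = 1) :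
    χ₈' ((t + 4 * u : ℤ) : ZMod 8) = if u % 2 = 0 then χ₈' (t : ZMod 8) else -χ₈' (t : ZMod 8) := by
  rw [χ₈'_int_eq_if_mod_eight, χ₈'_int_eq_if_mod_eight]
  split_ifs <;> omega

/-- Triples `(s, u, v)` with `s² + 16 u v = m` whose form `2 u X² + s X - 2 v` is negative at `-1` and
positive at `1`. -/
def crossingForms (m : ℤ) : Set (ℤ × ℤ × ℤ) :=
  {t | t.1 ^ 2 + 16 * t.2.1 * t.2.2 = m ∧ 2 * (t.2.1 - t.2.2) < t.1 ∧ 2 * (t.2.2 - t.2.1) < t.1}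

/-- Triples `(s, u, v)` with `s² + 16 u v = m` whose form `2 u X² + s X - 2 v` is negative at `-1` and
positive at infinity. -/
def cuspForms (m : ℤ) : Set (ℤ × ℤ × ℤ) :=
  {t | t.1 ^ 2 + 16 * t.2.1 * t.2.2 = m ∧ 0 < t.2.1 ∧ 2 * (t.2.1 - t.2.2) < t.1}

theorem finite_crossingForms (m : ℤ) : (crossingForms m).Finite := by
  refine ((Set.finite_Icc (-m) m).prod
    ((Set.finite_Icc (-m) m).prod (Set.finite_Icc (-m) m))).subset ?_
  rintro ⟨s, u, v⟩ ⟨h, h1, h2⟩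
  simp only at h h1 h2
  obtain ⟨a, ha⟩ : ∃ a, a = s + 2 * u - 2 * v := ⟨_, rfl⟩
  obtain ⟨b, hb⟩ : ∃ b, b = s - 2 * u + 2 * v := ⟨_, rfl⟩
  obtain ⟨c, hc⟩ : ∃ c, c = u + v := ⟨_, rfl⟩
  have hm : a * b + 4 * c ^ 2 = m := by rw [ha, hb, hc, ← h]; ring
  have ha0 : 1 ≤ a := by omega
  have hb0 : 1 ≤ b := by omega
  have hab : a + b ≤ a * b + 1 := by nlinarith
  have hc1 : c ≤ c ^ 2 := by nlinarith [Int.le_self_sq c]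
  have hc2 : -c ≤ c ^ 2 := by nlinarith [Int.le_self_sq (-c)]
  simp only [Set.mem_prod, Set.mem_Icc]
  refine ⟨⟨?_, ?_⟩, ⟨?_, ?_⟩, ?_, ?_⟩ <;> nlinarith

theorem finite_cuspForms (m : ℤ) : (cuspForms m).Finite := by
  refine ((Set.finite_Icc (-m) m).prod
    ((Set.finite_Icc (-m) m).prod (Set.finite_Icc (-m) m))).subset ?_
  rintro ⟨s, u, v⟩ ⟨h, h1, h2⟩
  simp only at h h1 h2
  obtain ⟨a, ha⟩ : ∃ a, a = s - 4 * u := ⟨_, rfl⟩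
  obtain ⟨b, hb⟩ : ∃ b, b = s - 2 * u + 2 * v := ⟨_, rfl⟩
  have hm : a ^ 2 + 8 * (u * b) = m := by rw [ha, hb, ← h]; ring
  have hb0 : 1 ≤ b := by omega
  have hab : u + b ≤ u * b + 1 := by nlinarith
  have ha1 : a ≤ a ^ 2 := Int.le_self_sq a
  have ha2 : -a ≤ a ^ 2 := by nlinarith [Int.le_self_sq (-a)]
  simp only [Set.mem_prod, Set.mem_Icc]
  refine ⟨⟨?_, ?_⟩, ⟨?_, ?_⟩, ?_, ?_⟩ <;> linarith

/-- The character sum over the crossing forms of given parities. -/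
noncomputable def crossingSum (m i j : ℤ) : ℤ :=
  ∑ t ∈ (finite_crossingForms m).toFinset with t.2.1 % 2 = i ∧ t.2.2 % 2 = j, χ₈' (t.1 : ZMod 8)

/-- The character sum over the cusp forms of given parities. -/
noncomputable def cuspSum (m i j : ℤ) : ℤ :=
  ∑ t ∈ (finite_cuspForms m).toFinset with t.2.1 % 2 = i ∧ t.2.2 % 2 = j, χ₈' (t.1 : ZMod 8)

theorem odd_of_sq_add_eq {m s u v : ℤ} (hm : m % 2 = 1) (h : s ^ 2 + 16 * u * v = m) :
    s % 2 = 1 := by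
  rcases Int.emod_two_eq_zero_or_one s with hs | hs
  · obtain ⟨k, rfl⟩ := Int.dvd_of_emod_eq_zero hs
    have : m = 2 * (2 * k ^ 2 + 8 * u * v) := by rw [← h]; ring
    omega
  · exact hs

theorem crossingSum_comm (m i j : ℤ) : crossingSum m i j = crossingSum m j i := by
  refine Finset.sum_nbij' (fun t => (t.1, t.2.2, t.2.1)) (fun t => (t.1, t.2.2, t.2.1)) ?_ ?_
    (fun _ _ => rfl) (fun _ _ => rfl) (fun _ _ => rfl) <;>
  · rintro ⟨s, u, v⟩ h
    simp only [crossingForms, Finset.mem_filter, Set.Finite.mem_toFinset, Set.mem_ofPred_eq] at h ⊢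
    exact ⟨⟨by rw [← h.1.1]; ring, h.1.2.2, h.1.2.1⟩, h.2.2, h.2.1⟩

theorem cuspSum_one_sub {m : ℤ} (hm : m % 2 = 1) (i j : ℤ) :
    cuspSum m i (1 - j) = -cuspSum m i j := by
  rw [cuspSum, cuspSum, ← Finset.sum_neg_distrib]
  refine Finset.sum_nbij' (fun t => (8 * t.2.1 - t.1, t.2.1, t.2.2 + t.1 - 4 * t.2.1))
    (fun t => (8 * t.2.1 - t.1, t.2.1, t.2.2 + t.1 - 4 * t.2.1)) ?_ ?_ ?_ ?_ ?_
  · rintro ⟨s, u, v⟩ h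
    simp only [cuspForms, Finset.mem_filter, Set.Finite.mem_toFinset, Set.mem_ofPred_eq] at h ⊢
    have := odd_of_sq_add_eq hm h.1.1
    exact ⟨⟨by rw [← h.1.1]; ring, by omega, by omega⟩, by omega, by omega⟩
  · rintro ⟨s, u, v⟩ h
    simp only [cuspForms, Finset.mem_filter, Set.Finite.mem_toFinset, Set.mem_ofPred_eq] at h ⊢
    have := odd_of_sq_add_eq hm h.1.1
    exact ⟨⟨by rw [← h.1.1]; ring, by omega, by omega⟩, by omega, by omega⟩
  · rintro ⟨s, u, v⟩ h
    simp only [Prod.mk.injEq]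
    exact ⟨by ring, trivial, by ring⟩
  · rintro ⟨s, u, v⟩ h
    simp only [Prod.mk.injEq]
    exact ⟨by ring, trivial, by ring⟩
  · rintro ⟨s, u, v⟩ h
    simp only
    rw [← χ₈'_int_neg]
    congr 1
    rw [ZMod.intCast_eq_intCast_iff]
    exact (Int.modEq_iff_dvd).2 ⟨-u, by push_cast; ring⟩

theorem crossingSum_eq_two_mul_cuspSum {m : ℤ} (hm : m % 2 = 1) (hsq : ¬ IsSquare m) (i j : ℤ) :
    crossingSum m i j = 2 * cuspSum m i j := by
  have h1 : ∑ t ∈ (finite_crossingForms m).toFinset with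
        (t.2.1 % 2 = i ∧ t.2.2 % 2 = j) ∧ ¬ 0 < t.2.1, χ₈' (t.1 : ZMod 8) =
      ∑ t ∈ (finite_crossingForms m).toFinset with
        (t.2.1 % 2 = i ∧ t.2.2 % 2 = j) ∧ 0 < t.2.1, χ₈' (t.1 : ZMod 8) := by
    refine Finset.sum_nbij' (fun t => (t.1, -t.2.1, -t.2.2)) (fun t => (t.1, -t.2.1, -t.2.2)) ?_ ?_
      (by simp) (by simp) (fun _ _ => rfl)
    · rintro ⟨s, u, v⟩ h
      simp only [crossingForms, Finset.mem_filter, Set.Finite.mem_toFinset, Set.mem_ofPred_eq] at h ⊢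
      have hu : u ≠ 0 := by
        rintro rfl
        exact hsq ⟨s, by rw [← h.1.1]; ring⟩
      exact ⟨⟨by rw [← h.1.1]; ring, by omega, by omega⟩, by omega, by omega⟩
    · rintro ⟨s, u, v⟩ h
      simp only [crossingForms, Finset.mem_filter, Set.Finite.mem_toFinset, Set.mem_ofPred_eq] at h ⊢
      exact ⟨⟨by rw [← h.1.1]; ring, by omega, by omega⟩, by omega, by omega⟩
  have h2 : ∑ t ∈ (finite_cuspForms m).toFinset with
        (t.2.1 % 2 = i ∧ t.2.2 % 2 = j) ∧ 2 * (t.2.2 - t.2.1) < t.1, χ₈' (t.1 : ZMod 8) =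
      ∑ t ∈ (finite_crossingForms m).toFinset with
        (t.2.1 % 2 = i ∧ t.2.2 % 2 = j) ∧ 0 < t.2.1, χ₈' (t.1 : ZMod 8) := by
    refine Finset.sum_congr ?_ fun _ _ => rfl
    ext ⟨s, u, v⟩
    simp only [crossingForms, cuspForms, Finset.mem_filter, Set.Finite.mem_toFinset,
      Set.mem_ofPred_eq]
    tauto
  have h3 : ∑ t ∈ (finite_cuspForms m).toFinset with
        (t.2.1 % 2 = i ∧ t.2.2 % 2 = j) ∧ ¬ 2 * (t.2.2 - t.2.1) < t.1, χ₈' (t.1 : ZMod 8) = 0 := by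
    rw [← self_eq_neg, ← Finset.sum_neg_distrib]
    refine Finset.sum_nbij' (fun t => (-t.1, t.2.1, t.2.2)) (fun t => (-t.1, t.2.1, t.2.2)) ?_ ?_
      (by simp) (by simp) ?_
    · rintro ⟨s, u, v⟩ h
      simp only [cuspForms, Finset.mem_filter, Set.Finite.mem_toFinset, Set.mem_ofPred_eq] at h ⊢
      have := odd_of_sq_add_eq hm h.1.1
      exact ⟨⟨by rw [← h.1.1]; ring, by omega, by omega⟩, by omega, by omega⟩
    · rintro ⟨s, u, v⟩ h
      simp only [cuspForms, Finset.mem_filter, Set.Finite.mem_toFinset, Set.mem_ofPred_eq] at h ⊢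
      have := odd_of_sq_add_eq hm h.1.1
      exact ⟨⟨by rw [← h.1.1]; ring, by omega, by omega⟩, by omega, by omega⟩
    · rintro ⟨s, u, v⟩ h
      simp only
      rw [χ₈'_int_neg, neg_neg]
  rw [crossingSum, cuspSum, ← Finset.sum_filter_add_sum_filter_not _ (fun t => 0 < t.2.1),
    ← Finset.sum_filter_add_sum_filter_not (Finset.filter _ (finite_cuspForms m).toFinset)
      (fun t => 2 * (t.2.2 - t.2.1) < t.1)]
  simp only [Finset.filter_filter]
  rw [h1, h2, h3]
  ring

theorem crossingSum_even_even {m : ℤ} (hm : m % 2 = 1) (hsq : ¬ IsSquare m) :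
    crossingSum m 0 0 = crossingSum m 1 1 := by
  have h1 := crossingSum_comm m 0 1
  rw [crossingSum_eq_two_mul_cuspSum hm hsq, crossingSum_eq_two_mul_cuspSum hm hsq] at h1 ⊢
  have h2 := cuspSum_one_sub hm 0 0
  have h3 := cuspSum_one_sub hm 1 0
  norm_num at h2 h3
  linarith


/-- The integers `Y` with `16 Y² < m`. -/
noncomputable def smallInts (m : ℤ) : Finset ℤ := {Y ∈ Finset.Icc (-m) m | 16 * Y ^ 2 < m}

theorem mem_smallInts {m Y : ℤ} : Y ∈ smallInts m ↔ 16 * Y ^ 2 < m := by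
  simp only [smallInts, Finset.mem_filter, Finset.mem_Icc, and_iff_right_iff_imp]
  intro h
  have h1 := Int.le_self_sq Y
  have h2 := Int.le_self_sq (-Y)
  constructor <;> nlinarith

theorem emod_eight_eq_of_mul {d e : ℤ} (h : d * e % 8 = 1) : d % 8 = e % 8 ∧ d % 2 = 1 := by
  rw [Int.mul_emod] at h
  have h1 := Int.emod_nonneg d (by norm_num : (8 : ℤ) ≠ 0)
  have h2 := Int.emod_lt_of_pos d (by norm_num : (0 : ℤ) < 8)
  have h3 := Int.emod_nonneg e (by norm_num : (8 : ℤ) ≠ 0)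
  have h4 := Int.emod_lt_of_pos e (by norm_num : (0 : ℤ) < 8)
  have h5 : d % 2 = d % 8 % 2 := by omega
  rw [h5]
  generalize d % 8 = x at *
  generalize e % 8 = y at *
  interval_cases x <;> interval_cases y <;> simp at h ⊢

theorem sum_smallInts_eq {m : ℤ} (hm : m % 8 = 1) :
    ∑ Y ∈ smallInts m, (if Y % 2 = 0 then 1 else -1) * sumCharNegTwo (m - 16 * Y ^ 2).toNat =
      crossingSum m 0 0 - crossingSum m 1 1 := by
  have h1 : crossingSum m 0 0 - crossingSum m 1 1 =
      ∑ t ∈ (finite_crossingForms m).toFinset with t.2.1 % 2 = t.2.2 % 2,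
        (if t.2.1 % 2 = 0 then χ₈' (t.1 : ZMod 8) else -χ₈' (t.1 : ZMod 8)) := by
    rw [crossingSum, crossingSum, Finset.sum_ite, Finset.sum_neg_distrib, sub_eq_add_neg]
    simp only [Finset.filter_filter]
    congr 2
    · ext t
      simp only [Finset.mem_filter, and_congr_right_iff]
      intro
      omega
    · congr 1
      ext t
      simp only [Finset.mem_filter, and_congr_right_iff]
      intro
      omega
  have h2 : ∑ Y ∈ smallInts m, (if Y % 2 = 0 then 1 else -1) *
        sumCharNegTwo (m - 16 * Y ^ 2).toNat =
      ∑ t ∈ (smallInts m).sigma fun Y => (m - 16 * Y ^ 2).toNat.divisorsAntidiagonal,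
        (if t.1 % 2 = 0 then 1 else -1) * χ₈' (t.2.1 : ZMod 8) := by
    rw [Finset.sum_sigma]
    refine Finset.sum_congr rfl fun Y _ => ?_
    rw [sumCharNegTwo_apply, Finset.mul_sum,
      ← Nat.sum_divisorsAntidiagonal fun d _ => (if Y % 2 = 0 then 1 else -1) * χ₈' (d : ZMod 8)]
  have key : ∀ (Y : ℤ) (d e : ℕ), 16 * Y ^ 2 < m → d * e = (m - 16 * Y ^ 2).toNat →
      (d : ℤ) * e + 16 * Y ^ 2 = m ∧ (d : ℤ) % 8 = e % 8 ∧ (d : ℤ) % 2 = 1 := by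
    intro Y d e hY h
    have h3 : (d : ℤ) * e = m - 16 * Y ^ 2 := by
      have : ((d * e : ℕ) : ℤ) = m - 16 * Y ^ 2 := by rw [h]; exact Int.toNat_of_nonneg (by omega)
      rw [← this]; push_cast; rfl
    have := emod_eight_eq_of_mul (d := d) (e := e) (by omega)
    exact ⟨by omega, this⟩
  rw [h1, h2]
  refine Finset.sum_bij'
    (fun t _ => ((t.2.1 + t.2.2 : ℤ) / 2, t.1 - (t.2.1 - t.2.2 : ℤ) / 8,
      t.1 + (t.2.1 - t.2.2 : ℤ) / 8))
    (fun t _ => ⟨(t.2.1 + t.2.2) / 2, (t.1 + 2 * (t.2.2 - t.2.1)).toNat,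
      (t.1 - 2 * (t.2.2 - t.2.1)).toNat⟩) ?_ ?_ ?_ ?_ ?_
  · rintro ⟨Y, d, e⟩ h
    simp only [Finset.mem_sigma, mem_smallInts, Nat.mem_divisorsAntidiagonal] at h
    obtain ⟨h3, h4, h5⟩ := key Y d e h.1 h.2.1
    simp only [crossingForms, Finset.mem_filter, Set.Finite.mem_toFinset, Set.mem_ofPred_eq]
    obtain ⟨T, hT⟩ : ∃ T : ℤ, (d : ℤ) = e + 8 * T := ⟨(d - e) / 8, by omega⟩
    have e1 : ((d : ℤ) + e) / 2 = e + 4 * T := by omega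
    have e2 : ((d : ℤ) - e) / 8 = T := by omega
    have hde : d ≠ 0 ∧ e ≠ 0 := by
      constructor <;> (rintro rfl; simp at h; omega)
    rw [e1, e2]
    refine ⟨⟨?_, by omega, by omega⟩, by omega⟩
    rw [← h3, hT]; ring
  · rintro ⟨s, u, v⟩ h
    simp only [crossingForms, Finset.mem_filter, Set.Finite.mem_toFinset, Set.mem_ofPred_eq] at h
    obtain ⟨⟨h3, h4, h5⟩, h6⟩ := h
    obtain ⟨T, hT⟩ : ∃ T : ℤ, v = u + 2 * T := ⟨(v - u) / 2, by omega⟩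
    subst hT
    have e1 : (u + (u + 2 * T)) / 2 = u + T := by omega
    have e2 : s + 2 * (u + 2 * T - u) = s + 4 * T := by ring
    have e3 : s - 2 * (u + 2 * T - u) = s - 4 * T := by ring
    simp only [Finset.mem_sigma, mem_smallInts, Nat.mem_divisorsAntidiagonal]
    rw [e1, e2, e3]
    have hpos : 0 < (s + 4 * T) * (s - 4 * T) := mul_pos (by omega) (by omega)
    have heq : (s + 4 * T) * (s - 4 * T) = m - 16 * (u + T) ^ 2 := by rw [← h3]; ring
    refine ⟨by omega, ?_, by omega⟩
    rw [← heq, Int.toNat_mul (by omega) (by omega)]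
  · rintro ⟨Y, d, e⟩ h
    simp only [Finset.mem_sigma, mem_smallInts, Nat.mem_divisorsAntidiagonal] at h
    obtain ⟨h3, h4, h5⟩ := key Y d e h.1 h.2.1
    simp only [Sigma.mk.injEq, heq_eq_eq, Prod.mk.injEq]
    exact ⟨by omega, by omega, by omega⟩
  · rintro ⟨s, u, v⟩ h
    simp only [crossingForms, Finset.mem_filter, Set.Finite.mem_toFinset, Set.mem_ofPred_eq] at h
    simp only [Prod.mk.injEq]
    refine ⟨by omega, by omega, by omega⟩
  · rintro ⟨Y, d, e⟩ h
    simp only [Finset.mem_sigma, mem_smallInts, Nat.mem_divisorsAntidiagonal] at h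
    obtain ⟨h3, h4, h5⟩ := key Y d e h.1 h.2.1
    simp only
    obtain ⟨T, hT⟩ : ∃ T : ℤ, (d : ℤ) = e + 8 * T := ⟨(d - e) / 8, by omega⟩
    have e1 : ((d : ℤ) + e) / 2 = e + 4 * T := by omega
    have e2 : ((d : ℤ) - e) / 8 = T := by omega
    have hd : χ₈' (d : ZMod 8) = χ₈' (((e + 4 * T) + 4 * T : ℤ) : ZMod 8) := by
      rw [show (e + 4 * T) + 4 * T = (d : ℤ) by omega]
      simp only [Int.cast_natCast]
    rw [e1, e2, hd, χ₈'_int_add_four_mul _ _ (by omega)]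
    split_ifs <;> omega

theorem exists_sq_add_eight_mul_sq_add_sixteen_mul_sq {m : ℕ} (hm : m % 8 = 1) :
    ∃ x w Y : ℤ, (m : ℤ) = x ^ 2 + 8 * w ^ 2 + 16 * Y ^ 2 := by
  have hsq : ∀ t : ℤ, t ^ 2 % 4 = t % 2 ∧ (t % 2 = 1 → t ^ 2 % 8 = 1) := by
    intro t
    rcases Int.even_or_odd' t with ⟨k, rfl | rfl⟩
    · have : (2 * k) ^ 2 = 4 * k ^ 2 := by ring
      omega
    · have h1 : (2 * k + 1) ^ 2 = 4 * (k * (k + 1)) + 1 := by ring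
      obtain ⟨l, hl⟩ := Int.even_mul_succ_self k
      omega
  have main : ∀ x y z : ℤ, (m : ℤ) = x ^ 2 + y ^ 2 + 2 * z ^ 2 → x % 2 = 1 → y % 2 = 0 →
      ∃ x w Y : ℤ, (m : ℤ) = x ^ 2 + 8 * w ^ 2 + 16 * Y ^ 2 := by
    intro x y z h hx hy
    have h1 := (hsq x).2 hx
    obtain ⟨y, rfl⟩ := Int.dvd_of_emod_eq_zero hy
    have hy2 : (2 * y) ^ 2 = 4 * y ^ 2 := by ring
    have h2 := hsq y
    have h3 := hsq z
    obtain ⟨z, rfl⟩ := Int.dvd_of_emod_eq_zero (by omega : z % 2 = 0)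
    have hz2 : (2 * z) ^ 2 = 4 * z ^ 2 := by ring
    obtain ⟨y, rfl⟩ := Int.dvd_of_emod_eq_zero (by omega : y % 2 = 0)
    exact ⟨x, z, y, by rw [h]; ring⟩
  have pair : ∀ a b c : ℤ, ((2 * m : ℕ) : ℤ) = a ^ 2 + b ^ 2 + c ^ 2 → a % 2 = 1 → b % 2 = 1 →
      ∃ x w Y : ℤ, (m : ℤ) = x ^ 2 + 8 * w ^ 2 + 16 * Y ^ 2 := by
    intro a b c h ha hb
    have h1 := hsq a
    have h2 := hsq b
    have h3 := hsq c
    obtain ⟨c, rfl⟩ := Int.dvd_of_emod_eq_zero (by omega : c % 2 = 0)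
    obtain ⟨p, rfl⟩ : ∃ p, a = 2 * p - b := ⟨(a + b) / 2, by omega⟩
    have hm' : (m : ℤ) = p ^ 2 + (p - b) ^ 2 + 2 * c ^ 2 := by
      push_cast at h
      linarith
    rcases Int.emod_two_eq_zero_or_one p with hp | hp
    · exact main (p - b) p c (by linarith) (by omega) hp
    · exact main p (p - b) c hm' hp (by omega)
  obtain ⟨a, b, c, h⟩ := exists_sum_three_sq_of_mod_four_eq_two (2 * m) (by omega)
  have h1 := hsq a
  have h2 := hsq b
  have h3 := hsq c
  by_cases hab : a % 2 = 1 ∧ b % 2 = 1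
  · exact pair a b c h hab.1 hab.2
  by_cases hac : a % 2 = 1 ∧ c % 2 = 1
  · exact pair a c b (by linarith) hac.1 hac.2
  · exact pair b c a (by linarith) (by omega) (by omega)

theorem sq_emod_eight_of_odd {t : ℤ} (ht : t % 2 = 1) : t ^ 2 % 8 = 1 := by
  obtain ⟨k, rfl⟩ : ∃ k, t = 2 * k + 1 := ⟨t / 2, by omega⟩
  have h1 : (2 * k + 1) ^ 2 = 4 * (k * (k + 1)) + 1 := by ring
  obtain ⟨l, hl⟩ := Int.even_mul_succ_self k
  omega

theorem exists_odd_of_not_isSquare {m : ℕ} (hm : m % 8 = 1) (hsq : ¬ IsSquare (m : ℤ)) :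
    ∃ x w Y : ℤ, Y % 2 = 1 ∧ (m : ℤ) = x ^ 2 + 8 * w ^ 2 + 16 * Y ^ 2 := by
  obtain ⟨x, w, Y, h⟩ := exists_sq_add_eight_mul_sq_add_sixteen_mul_sq hm
  rcases Int.emod_two_eq_zero_or_one Y with hY | hY
  swap
  · exact ⟨x, w, Y, hY, h⟩
  have hx : x ≠ 0 := by
    rintro rfl
    omega
  have hlt : 16 * Y ^ 2 < (m : ℤ) := by
    have : 0 < x ^ 2 := by positivity
    nlinarith [sq_nonneg w]
  have hpos : 0 < sumCharNegTwo ((m : ℤ) - 16 * Y ^ 2).toNat := by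
    have h0 : ((m : ℤ) - 16 * Y ^ 2).toNat ≠ 0 := by omega
    rw [sumCharNegTwo_pos_iff h0, ← eq_sq_add_two_mul_sq_iff h0]
    exact ⟨x, 2 * w, by rw [Int.toNat_of_nonneg (by omega), h]; ring⟩
  have hsum := sum_smallInts_eq (m := m) (by omega)
  rw [crossingSum_even_even (by omega) hsq, sub_self] at hsum
  obtain ⟨Z, hZ, hneg⟩ : ∃ Z ∈ smallInts m,
      (if Z % 2 = 0 then 1 else -1) * sumCharNegTwo ((m : ℤ) - 16 * Z ^ 2).toNat < 0 := by
    by_contra! hall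
    have := (Finset.sum_eq_zero_iff_of_nonneg hall).1 hsum Y (mem_smallInts.2 hlt)
    simp only [hY, if_true, one_mul] at this
    exact hpos.ne' this
  have hnn := sumCharNegTwo_nonneg ((m : ℤ) - 16 * Z ^ 2).toNat
  rw [mem_smallInts] at hZ
  split_ifs at hneg with hZ2
  · linarith
  · have h0 : ((m : ℤ) - 16 * Z ^ 2).toNat ≠ 0 := by omega
    obtain ⟨a, b, hab⟩ := (eq_sq_add_two_mul_sq_iff h0).2
      ((sumCharNegTwo_pos_iff h0).1 (by linarith))
    rw [Int.toNat_of_nonneg (by omega)] at hab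
    have ha : a % 2 = 1 := by
      by_contra hc
      obtain ⟨k, rfl⟩ : ∃ k, a = 2 * k := ⟨a / 2, by omega⟩
      have : (2 * k) ^ 2 = 4 * k ^ 2 := by ring
      omega
    have ha2 := sq_emod_eight_of_odd ha
    have hb : b % 2 = 0 := by
      by_contra hc
      have := sq_emod_eight_of_odd (by omega : b % 2 = 1)
      omega
    obtain ⟨b, rfl⟩ := Int.dvd_of_emod_eq_zero hb
    exact ⟨a, b, Z, by omega, by linarith⟩

theorem exists_odd_of_sq {p : ℕ} (hp : p % 8 = 5 ∨ p % 8 = 7) :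
    ∃ x w Y : ℤ, Y % 2 = 1 ∧ (p : ℤ) ^ 2 = x ^ 2 + 8 * w ^ 2 + 16 * Y ^ 2 := by
  have hsq : ∀ t : ℤ, t ^ 2 % 4 = t % 2 := by
    intro t
    rcases Int.even_or_odd' t with ⟨k, rfl | rfl⟩ <;> ring_nf <;> omega
  obtain ⟨a, b, c, d, h⟩ : ∃ a b c d : ℤ, (p : ℤ) = a ^ 2 + 2 * b ^ 2 + 2 * c ^ 2 + 4 * d ^ 2 := by
    have key : ∀ a b c d : ℤ, (p : ℤ) = a ^ 2 + b ^ 2 + c ^ 2 + d ^ 2 → a % 2 = 1 → d % 2 = 0 →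
        ∃ a b c d : ℤ, (p : ℤ) = a ^ 2 + 2 * b ^ 2 + 2 * c ^ 2 + 4 * d ^ 2 := by
      intro a b c d h ha hd
      have h1 := hsq a
      have h2 := hsq b
      have h3 := hsq c
      have h4 := hsq d
      obtain ⟨d, rfl⟩ := Int.dvd_of_emod_eq_zero hd
      obtain ⟨t, rfl⟩ : ∃ t, b = 2 * t - c := ⟨(b + c) / 2, by omega⟩
      exact ⟨a, t, t - c, d, by linarith⟩
    obtain ⟨a, b, c, d, h⟩ := Nat.sum_four_squares p
    have h' : (p : ℤ) = (a : ℤ) ^ 2 + (b : ℤ) ^ 2 + (c : ℤ) ^ 2 + (d : ℤ) ^ 2 := by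
      exact_mod_cast h.symm
    generalize (a : ℤ) = a at h'
    generalize (b : ℤ) = b at h'
    generalize (c : ℤ) = c at h'
    generalize (d : ℤ) = d at h'
    have h1 := hsq a
    have h2 := hsq b
    have h3 := hsq c
    have h4 := hsq d
    by_contra hcon
    have key' : ∀ a b c d : ℤ, (p : ℤ) = a ^ 2 + b ^ 2 + c ^ 2 + d ^ 2 →
        ¬ (a % 2 = 1 ∧ d % 2 = 0) := fun a b c d h h0 => hcon (key a b c d h h0.1 h0.2)
    have k1 := key' a b c d (by linarith)
    have k2 := key' a b d c (by linarith)
    have k3 := key' a c d b (by linarith)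
    have k4 := key' b a c d (by linarith)
    have k5 := key' b a d c (by linarith)
    have k6 := key' b c d a (by linarith)
    have k7 := key' c a b d (by linarith)
    have k8 := key' c a d b (by linarith)
    have k9 := key' c b d a (by linarith)
    have k10 := key' d a b c (by linarith)
    have k11 := key' d a c b (by linarith)
    have k12 := key' d b c a (by linarith)
    omega
  refine ⟨a ^ 2 + 2 * b ^ 2 - 2 * c ^ 2 - 4 * d ^ 2, a * c - 2 * b * d, a * d + b * c, ?_,
    by rw [h]; ring⟩
  have h1 := hsq a
  have h2 := hsq b
  have h3 := hsq c
  have h4 := hsq d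
  have ha := sq_emod_eight_of_odd (by omega : a % 2 = 1)
  have e : (a * d + b * c) % 2 = (a % 2 * (d % 2) + b % 2 * (c % 2)) % 2 := by
    simp [Int.add_emod, Int.mul_emod]
  rw [e, (by omega : a % 2 = 1)]
  rcases Int.emod_two_eq_zero_or_one b with hb | hb <;>
  rcases Int.emod_two_eq_zero_or_one c with hc | hc <;> rw [hb, hc] <;> omega

theorem even_of_mul_eq {U V : ℕ} {w Y : ℤ} (hU : U % 2 = 1)
    (hE : (U + V) % 8 = 1 ∨ (U + V) % 8 = 3)
    (hp : ∀ p : ℕ, p.Prime → χ₈' (p : ZMod 8) = -1 → ¬ p ∣ U + V)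
    (h : (U : ℤ) * V = 2 * w ^ 2 + 4 * Y ^ 2) : Y % 2 = 0 := by
  by_contra hY
  have hY2 := sq_emod_eight_of_odd (by omega : Y % 2 = 1)
  have hU0 : U ≠ 0 := by omega
  have hV0 : V ≠ 0 := by
    rintro rfl
    have := sq_nonneg w
    have := sq_nonneg Y
    simp at h
    omega
  have hrep := (eq_sq_add_two_mul_sq_iff (mul_ne_zero hU0 hV0)).1
    ⟨2 * Y, w, by push_cast; rw [h]; ring⟩
  obtain ⟨a, b, hab⟩ := (eq_sq_add_two_mul_sq_iff hU0).2 fun p hpp hχ => by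
    by_cases hpU : p ∣ U
    · have hpV : ¬ p ∣ V := fun hpV => hp p hpp hχ (dvd_add hpU hpV)
      have := hrep p hpp hχ
      rwa [Nat.factorization_mul hU0 hV0, Finsupp.add_apply,
        Nat.factorization_eq_zero_of_not_dvd hpV, add_zero] at this
    · simp [Nat.factorization_eq_zero_of_not_dvd hpU]
  have hsq : ∀ t : ℤ, t ^ 2 % 4 = t % 2 := by
    intro t
    rcases Int.even_or_odd' t with ⟨k, rfl | rfl⟩ <;> ring_nf <;> omega
  have h1 := hsq a
  have h2 := hsq b
  have h3 := hsq w
  have h4 := sq_emod_eight_of_odd (by omega : a % 2 = 1)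
  have hUV : ((U : ℤ) * V) % 8 = ((U : ℤ) % 8 * V) % 8 := by simp [Int.mul_emod]
  have hU8 : (U : ℤ) % 8 = 1 ∨ (U : ℤ) % 8 = 3 := by omega
  rcases hU8 with h5 | h5 <;> rw [h5] at hUV <;> omega

theorem mod_eight_of_forall_prime {E : ℕ} (hE : 0 < E)
    (h : ∀ p : ℕ, p.Prime → p ∣ E → p % 8 = 1 ∨ p % 8 = 3) : E % 8 = 1 ∨ E % 8 = 3 := by
  induction E using induction_on_primes with
  | zero => omega
  | one => simp
  | prime_mul p a hp ih =>
    have h1 := h p hp (dvd_mul_right p a)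
    have h2 := ih (Nat.pos_of_mul_pos_left hE) fun q hq hqa => h q hq (dvd_mul_of_dvd_right hqa p)
    rw [Nat.mul_mod]
    rcases h1 with h1 | h1 <;> rcases h2 with h2 | h2 <;> simp [h1, h2]

theorem even_of_sq_eq {E : ℕ} (hE : 0 < E)
    (hp : ∀ p : ℕ, p.Prime → p ∣ E → p % 8 = 1 ∨ p % 8 = 3) {x w Y : ℤ}
    (h : (E : ℤ) ^ 2 = x ^ 2 + 8 * w ^ 2 + 16 * Y ^ 2) : Y % 2 = 0 := by
  have hE8 := mod_eight_of_forall_prime hE hp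
  have hx : x % 2 = 1 := by
    by_contra hc
    have h1 := sq_emod_eight_of_odd (by omega : (E : ℤ) % 2 = 1)
    obtain ⟨k, rfl⟩ : ∃ k, x = 2 * k := ⟨x / 2, by omega⟩
    have : (2 * k) ^ 2 = 4 * k ^ 2 := by ring
    omega
  have habs : |x| ≤ E := abs_le_of_sq_le_sq (by nlinarith [sq_nonneg w, sq_nonneg Y]) (by omega)
  obtain ⟨hx1, hx2⟩ := abs_le.1 habs
  obtain ⟨U, hU⟩ : ∃ U : ℕ, (E : ℤ) - x = 2 * U := ⟨(((E : ℤ) - x) / 2).toNat, by omega⟩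
  obtain ⟨V, hV⟩ : ∃ V : ℕ, (E : ℤ) + x = 2 * V := ⟨(((E : ℤ) + x) / 2).toNat, by omega⟩
  have hUV : (U : ℤ) * V = 2 * w ^ 2 + 4 * Y ^ 2 := by
    have : (2 * (U : ℤ)) * (2 * V) = 8 * w ^ 2 + 16 * Y ^ 2 := by
      rw [← hU, ← hV]; linear_combination h
    linarith
  have hsum : U + V = E := by omega
  have hp' : ∀ p : ℕ, p.Prime → χ₈' (p : ZMod 8) = -1 → ¬ p ∣ U + V := by
    intro p hpp hχ hdvd
    rw [hsum] at hdvd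
    have := hp p hpp hdvd
    rw [χ₈'_nat_eq_if_mod_eight, if_neg (by omega), if_pos this] at hχ
    norm_num at hχ
  rcases Nat.mod_two_eq_zero_or_one U with hU2 | hU2
  · exact even_of_mul_eq (U := V) (V := U) (by omega) (by omega)
      (by rwa [add_comm V U]) (by rw [mul_comm]; exact hUV)
  · exact even_of_mul_eq hU2 (by omega) hp' hUV

theorem card_eq_zero_iff_forall_even (n : ℕ) :
    Nat.card {v : ℤ × ℤ × ℤ //
        v.1 ^ 2 + v.2.1 ^ 2 + 2 * v.2.2 ^ 2 = 8 * (n : ℤ) + 1 ∧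
        v.1 ≡ 1 [ZMOD 4] ∧ v.2.1 ≡ 4 [ZMOD 16] ∧ v.2.2 ≡ 0 [ZMOD 2]} = 0 ↔
      ∀ x w Y : ℤ, ((8 * n + 1 : ℕ) : ℤ) = x ^ 2 + 8 * w ^ 2 + 16 * Y ^ 2 → Y % 2 = 0 := by
  have hfin : Finite {v : ℤ × ℤ × ℤ //
      v.1 ^ 2 + v.2.1 ^ 2 + 2 * v.2.2 ^ 2 = 8 * (n : ℤ) + 1 ∧
      v.1 ≡ 1 [ZMOD 4] ∧ v.2.1 ≡ 4 [ZMOD 16] ∧ v.2.2 ≡ 0 [ZMOD 2]} := by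
    have hI := Set.finite_Icc (-(8 * (n : ℤ) + 1)) (8 * (n : ℤ) + 1)
    refine Set.Finite.to_subtype ((hI.prod (hI.prod hI)).subset ?_)
    rintro ⟨x, y, z⟩ ⟨h, -⟩
    simp only at h
    simp only [Set.mem_prod, Set.mem_Icc]
    have h1 := Int.le_self_sq x
    have h2 := Int.le_self_sq (-x)
    have h3 := Int.le_self_sq y
    have h4 := Int.le_self_sq (-y)
    have h5 := Int.le_self_sq z
    have h6 := Int.le_self_sq (-z)
    refine ⟨⟨?_, ?_⟩, ⟨?_, ?_⟩, ?_, ?_⟩ <;> nlinarith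
  rw [Finite.card_eq_zero_iff]
  constructor
  · intro hempty x w Y h
    by_contra hY
    have hx : x % 2 = 1 := by
      by_contra hc
      obtain ⟨k, rfl⟩ : ∃ k, x = 2 * k := ⟨x / 2, by omega⟩
      have : (2 * k) ^ 2 = 4 * k ^ 2 := by ring
      push_cast at h
      omega
    have hx' : ∃ x' : ℤ, x' ^ 2 = x ^ 2 ∧ x' % 4 = 1 := by
      by_cases hc : x % 4 = 1
      · exact ⟨x, rfl, hc⟩
      · exact ⟨-x, by ring, by omega⟩
    have hY' : ∃ Y' : ℤ, Y' ^ 2 = Y ^ 2 ∧ Y' % 4 = 1 := by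
      by_cases hc : Y % 4 = 1
      · exact ⟨Y, rfl, hc⟩
      · exact ⟨-Y, by ring, by omega⟩
    obtain ⟨x', hx1, hx2⟩ := hx'
    obtain ⟨Y', hY1, hY2⟩ := hY'
    refine hempty.false ⟨(x', 4 * Y', 2 * w), ?_, ?_, ?_, ?_⟩
    · push_cast at h
      simp only
      rw [h, ← hx1, ← hY1]
      ring
    · exact hx2
    · change 4 * Y' % 16 = 4 % 16
      omega
    · change 2 * w % 2 = 0 % 2
      omega
  · rintro hall
    refine ⟨?_⟩
    rintro ⟨⟨x, y, z⟩, h, -, hy, hz⟩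
    simp only [Int.ModEq] at h hy hz
    obtain ⟨Y, rfl⟩ : ∃ Y, y = 4 * Y := ⟨y / 4, by omega⟩
    obtain ⟨w, rfl⟩ : ∃ w, z = 2 * w := ⟨z / 2, by omega⟩
    have := hall x w Y (by push_cast; rw [← h]; ring)
    omega

theorem stmt_12 (n : ℕ) (hn : 0 < n) :
    Nat.card {v : ℤ × ℤ × ℤ //
        v.1 ^ 2 + v.2.1 ^ 2 + 2 * v.2.2 ^ 2 = 8 * (n : ℤ) + 1 ∧
        v.1 ≡ 1 [ZMOD 4] ∧ v.2.1 ≡ 4 [ZMOD 16] ∧ v.2.2 ≡ 0 [ZMOD 2]} = 0 ↔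
      ∃ E : ℕ, 0 < E ∧ 8 * n + 1 = E ^ 2 ∧
        ∀ p : ℕ, p.Prime → p ∣ E → p % 8 = 1 ∨ p % 8 = 3 := by
  rw [card_eq_zero_iff_forall_even]
  constructor
  · intro hall
    by_cases hsq : IsSquare ((8 * n + 1 : ℕ) : ℤ)
    · obtain ⟨r, hr⟩ := hsq
      have hE : 8 * n + 1 = r.natAbs ^ 2 := by
        zify
        rw [sq_abs, sq]
        exact_mod_cast hr
      refine ⟨r.natAbs, Nat.pos_of_ne_zero fun h0 => by simp [h0] at hE, hE, ?_⟩
      rintro p hp ⟨k, hk⟩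
      rw [hk] at hE
      have hodd : (p * k) % 2 = 1 := by
        rcases Nat.mod_two_eq_zero_or_one (p * k) with h0 | h0
        · have := Nat.pow_mod (p * k) 2 2
          rw [h0] at this
          omega
        · exact h0
      have hp2 : p % 2 = 1 := Nat.odd_iff.1 (Nat.odd_mul.1 (Nat.odd_iff.2 hodd)).1
      have hk2 : k % 2 = 1 := Nat.odd_iff.1 (Nat.odd_mul.1 (Nat.odd_iff.2 hodd)).2
      by_contra hc
      obtain ⟨x, w, Y, hY, h⟩ := exists_odd_of_sq (p := p) (by omega)
      have := hall (k * x) (k * w) (k * Y) (by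
        rw [hE]
        push_cast
        rw [mul_pow, h]
        ring)
      rw [Int.mul_emod, hY, (by omega : (k : ℤ) % 2 = 1)] at this
      norm_num at this
    · obtain ⟨x, w, Y, hY, h⟩ := exists_odd_of_not_isSquare (m := 8 * n + 1) (by omega) hsq
      have := hall x w Y h
      omega
  · rintro ⟨E, hE, hEq, hp⟩ x w Y h
    rw [hEq] at h
    push_cast at h
    exact even_of_sq_eq hE hp h
end
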